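/- arXiv:1309.4986 — 5 statements merged into one kernel-verified Lean document; each statement's English description precedes it below -/
import Mathlib

section
/- Let d be a positive integer and let J ⊊ I be squarefree monomial ideals of S such that I is minimally generated by squarefree monomials f_1,…,f_r of degree d together with a set E of squarefree monomials of degrees ≥ d+1, and J is either 0 or generated by squarefree monomials of degrees ≥ d+1. If s < 2r, then depth_S I/J ≤ d+1. -/
open MvPolynomial

/-- The squarefree monomial `∏_{i ∈ T} x_i` in `K[x_1,…,x_n]`. -/
noncomputable def sqm (K : Type*) [Field K] {n : ℕ} (T : Finset (Fin n)) :
    MvPolynomial (Fin n) K := ∏ i ∈ T, X i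

/-- The poset `P_{I \ J}` of (supports of) squarefree monomials of `I \ J`. -/
def sqPoset {K : Type*} [Field K] {n : ℕ} (I J : Ideal (MvPolynomial (Fin n) K)) :
    Set (Finset (Fin n)) :=
  {T | sqm K T ∈ I ∧ sqm K T ∉ J}

/-- The squarefree monomials of degree `k` in `I \ J`. -/
def degSet {K : Type*} [Field K] {n : ℕ} (I J : Ideal (MvPolynomial (Fin n) K)) (k : ℕ) :
    Set (Finset (Fin n)) :=
  {T ∈ sqPoset I J | T.card = k}

/-- A partition of `P_{I\J}` into intervals `[u,v]`, recorded as a finite set of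
pairs `(u, v)`: each monomial of `P_{I\J}` lies in exactly one interval. -/
def IsIntervalPartition {K : Type*} [Field K] {n : ℕ}
    (I J : Ideal (MvPolynomial (Fin n) K))
    (F : Finset (Finset (Fin n) × Finset (Fin n))) : Prop :=
  (∀ p ∈ F, p.1 ∈ sqPoset I J ∧ p.2 ∈ sqPoset I J ∧ p.1 ⊆ p.2) ∧
  (∀ T ∈ sqPoset I J, ∃! p, p ∈ F ∧ p.1 ⊆ T ∧ T ⊆ p.2)

/-- The Stanley depth of `I/J`: the maximum over interval partitions of the
minimal degree of an upper endpoint. -/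
noncomputable def sdepth {K : Type*} [Field K] {n : ℕ}
    (I J : Ideal (MvPolynomial (Fin n) K)) : ℕ :=
  sSup {k | ∃ F, IsIntervalPartition I J F ∧ ∀ p ∈ F, k ≤ p.2.card}

/-- The depth of a module over `K[x_1,…,x_n]` with respect to the maximal ideal
`(x_1,…,x_n)`: the supremum of lengths of regular sequences from `(x_1,…,x_n)`. -/
noncomputable def mdepth {K : Type*} [Field K] {n : ℕ}
    (M : Type*) [AddCommGroup M] [Module (MvPolynomial (Fin n) K) M] : ℕ :=
  sSup {k | ∃ rs : List (MvPolynomial (Fin n) K), rs.length = k ∧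
    (∀ r ∈ rs, r ∈ Ideal.span (Set.range X : Set (MvPolynomial (Fin n) K))) ∧
    RingTheory.Sequence.IsRegular M rs}

/-- The `S`-module `I/J` (more precisely `I/(J ∩ I)`). -/
abbrev quotMod {K : Type*} [Field K] {n : ℕ} (I J : Ideal (MvPolynomial (Fin n) K)) :=
  I ⧸ (Submodule.comap I.subtype J)

/-- `depth_S I/J`. -/
noncomputable def depthIJ {K : Type*} [Field K] {n : ℕ}
    (I J : Ideal (MvPolynomial (Fin n) K)) : ℕ :=
  mdepth (K := K) (n := n) (quotMod I J)

/-- An ideal is a squarefree monomial ideal generated in degrees `≥ d` if it is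
the span of squarefree monomials whose supports have at least `d` elements. -/
def SqfreeGenFrom {K : Type*} [Field K] {n : ℕ}
    (L : Ideal (MvPolynomial (Fin n) K)) (d : ℕ) : Prop :=
  ∃ G : Set (Finset (Fin n)), (∀ T ∈ G, d ≤ T.card) ∧ L = Ideal.span (sqm K '' G)

/-- A squarefree monomial ideal. -/
def IsSqfreeMonomialIdeal {K : Type*} [Field K] {n : ℕ}
    (L : Ideal (MvPolynomial (Fin n) K)) : Prop :=
  ∃ G : Set (Finset (Fin n)), L = Ideal.span (sqm K '' G)

section LinearRegularSequence

open RingTheory.Sequence CategoryTheory Abelian Limits Pointwise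

universe u

variable {L R : Type u} [Field L] [CommRing R] [Algebra L R]

/-- Prime avoidance for a vector space `W` of ring elements over an infinite field. -/
lemma exists_isSMulRegular_mem_subspace [Infinite L] [IsNoetherianRing R] (W : Submodule L R)
    (M : Type*) [AddCommGroup M] [Module R M] [Module.Finite R M] {a : R}
    (ha : a ∈ Ideal.span (W : Set R)) (hreg : IsSMulRegular M a) :
    ∃ w ∈ W, IsSMulRegular M w := by
  by_contra! h
  have := (associatedPrimes.finite R M).to_subtype
  obtain ⟨⟨p, hp⟩, hpW⟩ := Subspace.exists_eq_top_of_iUnion_eq_univ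
    (p := fun p : associatedPrimes R M ↦ ((p : Ideal R).restrictScalars L).comap W.subtype) <| by
    refine Set.eq_univ_of_forall fun ⟨w, hw⟩ ↦ ?_
    have : w ∈ ⋃ p ∈ associatedPrimes R M, (p : Set R) := by
      rw [biUnion_associatedPrimes_eq_compl_regular]
      exact h w hw
    simpa using this
  have hle : Ideal.span (W : Set R) ≤ p := by
    refine Ideal.span_le.2 fun w hw ↦ ?_
    have : (⟨w, hw⟩ : W) ∈ (p.restrictScalars L).comap W.subtype := hpW ▸ Submodule.mem_top
    simpa using this
  have : a ∈ ⋃ p ∈ associatedPrimes R M, (p : Set R) := Set.mem_biUnion hp (hle ha)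
  rw [biUnion_associatedPrimes_eq_compl_regular] at this
  exact this hreg

lemma exists_isWeaklyRegular_mem_subspace_of_subsingleton_ext [Infinite L] [IsNoetherianRing R]
    (W : Submodule L R) (k : ℕ) (M : ModuleCat.{u} R) [Module.Finite R M]
    (h_ext : ∀ i < k, Subsingleton (Ext (ModuleCat.of R (R ⧸ Ideal.span (W : Set R))) M i)) :
    ∃ rs : List R, rs.length = k ∧ (∀ r ∈ rs, r ∈ W) ∧ IsWeaklyRegular M rs := by
  induction k generalizing M with
  | zero => exact ⟨[], by simp⟩
  | succ k ih =>
    let N := ModuleCat.of R (R ⧸ Ideal.span (W : Set R))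
    have : Subsingleton (N ⟶ M) := Ext.addEquiv₀.subsingleton_congr.mp (h_ext 0 k.zero_lt_succ)
    have : Subsingleton (N →ₗ[R] M) := ModuleCat.homAddEquiv.symm.subsingleton
    obtain ⟨a, mem_ann, ha⟩ := IsSMulRegular.subsingleton_linearMap_iff.mp this
    rw [show Module.annihilator R N = Ideal.span (W : Set R) from Ideal.annihilator_quotient]
      at mem_ann
    obtain ⟨w, hwW, hw⟩ := exists_isSMulRegular_mem_subspace W M mem_ann ha
    have h_ext' : ∀ i < k, Subsingleton (Ext N (ModuleCat.of R (QuotSMulTop w M)) i) := by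
      intro i hi
      have zero1 := AddCommGrpCat.isZero_of_iff_subsingleton.mpr (h_ext i (by omega))
      have zero2 := AddCommGrpCat.isZero_of_iff_subsingleton.mpr (h_ext (i + 1) (by omega))
      exact AddCommGrpCat.subsingleton_of_isZero <| ShortComplex.Exact.isZero_of_both_zeros
        ((Ext.covariant_sequence_exact₃' N hw.smulShortComplex_shortExact) i (i + 1) rfl)
        (zero1.eq_zero_of_src _) (zero2.eq_zero_of_tgt _)
    obtain ⟨rs, len, mem, reg⟩ := ih (ModuleCat.of R (QuotSMulTop w M)) h_ext'
    exact ⟨w :: rs, by simp [len], by simpa [hwW] using mem, .cons hw reg⟩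

/-- Over an infinite field, a regular sequence in the ideal generated by a vector space `W` can be
replaced by a weakly regular sequence of the same length in `W`. -/
lemma exists_isWeaklyRegular_mem_subspace [Infinite L] [IsNoetherianRing R] (W : Submodule L R)
    (M : Type u) [AddCommGroup M] [Module R M] [Module.Finite R M] (rs : List R)
    (mem : ∀ r ∈ rs, r ∈ Ideal.span (W : Set R)) (reg : IsWeaklyRegular M rs)
    (hM : Ideal.span (W : Set R) • (⊤ : Submodule R M) ≠ ⊤) :
    ∃ ws : List R, ws.length = rs.length ∧ (∀ w ∈ ws, w ∈ W) ∧ IsWeaklyRegular M ws := by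
  refine exists_isWeaklyRegular_mem_subspace_of_subsingleton_ext W rs.length (ModuleCat.of R M) ?_
  refine ModuleCat.subsingleton_ext_of_exists_isRegular (Ideal.span (W : Set R))
    (ModuleCat.of R (R ⧸ Ideal.span (W : Set R))) ?_ (ModuleCat.of R M) hM.lt_top rs mem ⟨reg, ?_⟩
  · rw [Module.support_eq_zeroLocus]
    exact (congrArg (fun I : Ideal R ↦ PrimeSpectrum.zeroLocus (I : Set R))
      Ideal.annihilator_quotient).subset
  · exact fun h ↦ hM (top_le_iff.1 (h.le.trans (Submodule.smul_mono_left (Ideal.span_le.2 mem))))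

/-- A relation `∑ rⱼ vⱼ = 0` along a weakly regular sequence in `I` is trivial if the only
coefficients `vⱼ` lying in `IM` are zero. -/
lemma RingTheory.Sequence.IsWeaklyRegular.eq_zero_of_sum_smul_eq_zero {A : Type*} [CommRing A]
    {I : Ideal A} {rs : List A} (hrs : ∀ r ∈ rs, r ∈ I)
    {M : Type*} [AddCommGroup M] [Module A M] (reg : IsWeaklyRegular M rs)
    (v : Fin rs.length → M) (hv : ∀ j, v j ∈ I • (⊤ : Submodule A M) → v j = 0)
    (hsum : ∑ j, rs.get j • v j = 0) (j : Fin rs.length) : v j = 0 := by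
  induction rs generalizing M with
  | nil => exact j.elim0
  | cons a rs ih =>
    rw [isWeaklyRegular_cons_iff] at reg
    simp only [List.mem_cons, forall_eq_or_imp] at hrs
    have hle : a • (⊤ : Submodule A M) ≤ I • ⊤ := by
      rw [← Submodule.ideal_span_singleton_smul]
      exact Submodule.smul_mono_left ((Ideal.span_singleton_le_iff_mem I).2 hrs.1)
    have hlift (x : M) (hx : (a • (⊤ : Submodule A M)).mkQ x ∈
        I • (⊤ : Submodule A (QuotSMulTop a M))) : x ∈ I • (⊤ : Submodule A M) := by
      rw [← Submodule.mem_comap, Submodule.comap_smul_top_of_surjective I _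
        (Submodule.mkQ_surjective _), Submodule.ker_mkQ] at hx
      exact sup_le le_rfl hle hx
    replace hsum : a • v 0 + ∑ i : Fin rs.length, rs.get i • v i.succ = 0 :=
      (Fin.sum_univ_succ (n := rs.length) _).symm.trans hsum
    have htail (i : Fin rs.length) : v i.succ = 0 := by
      have := ih hrs.2 reg.2 (fun i ↦ (a • (⊤ : Submodule A M)).mkQ (v i.succ))
        (fun i hi ↦ by rw [hv _ (hlift _ hi), map_zero]) ?_ i
      · exact hv _ (hlift _ (this ▸ zero_mem _))
      · have h := congrArg (a • (⊤ : Submodule A M)).mkQ hsum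
        have h0 : (a • (⊤ : Submodule A M)).mkQ (a • v 0) = 0 :=
          (Submodule.Quotient.mk_eq_zero _).2 (Submodule.smul_mem_pointwise_smul _ _ _ trivial)
        rw [map_add, map_sum, map_zero] at h
        refine Eq.trans ?_ ((zero_add _).symm.trans ((congrArg (· + _) h0.symm).trans h))
        rfl
    refine Fin.cases ?_ htail j
    refine reg.1 ?_
    simpa [htail] using hsum

end LinearRegularSequence

section BaseChange

open TensorProduct

attribute [local instance] MvPolynomial.algebraMvPolynomial

lemma sqm_eq_monomial (K : Type*) [Field K] {n : ℕ} (T : Finset (Fin n)) :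
    sqm K T = monomial (∑ i ∈ T, Finsupp.single i 1) 1 := by
  rw [sqm, monomial_sum_one]
  rfl

lemma degree_sum_single_one {n : ℕ} (T : Finset (Fin n)) :
    (∑ i ∈ T, Finsupp.single i 1 : Fin n →₀ ℕ).degree = T.card := by
  simp [map_sum]

lemma sum_single_one_injective (n : ℕ) :
    Function.Injective fun T : Finset (Fin n) ↦ (∑ i ∈ T, Finsupp.single i 1 : Fin n →₀ ℕ) := by
  classical
  intro T T' h
  ext j
  have := DFunLike.congr_fun h j
  simp only [Finsupp.coe_finsetSum, Finset.sum_apply, Finsupp.single_apply,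
    Finset.sum_ite_eq'] at this
  grind

lemma span_sqm_le_pow_idealOfVars (K : Type*) [Field K] {n d : ℕ} {G : Set (Finset (Fin n))}
    (hG : ∀ T ∈ G, d ≤ T.card) : Ideal.span (sqm K '' G) ≤ idealOfVars (Fin n) K ^ d := by
  rw [Ideal.span_le]
  rintro _ ⟨T, hT, rfl⟩
  rw [sqm_eq_monomial, SetLike.mem_coe, monomial_mem_pow_idealOfVars_iff _ _ one_ne_zero,
    degree_sum_single_one]
  exact hG T hT

lemma mem_idealOfVars_iff {σ R : Type*} [CommRing R] (p : MvPolynomial σ R) :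
    p ∈ idealOfVars σ R ↔ constantCoeff p = 0 := by
  rw [← pow_one (idealOfVars σ R), mem_pow_idealOfVars_iff']
  simp [constantCoeff_eq, Finsupp.degree_eq_zero_iff]

lemma constantCoeff_algebraMap {σ K L : Type*} [CommRing K] [CommRing L] [Algebra K L]
    (q : MvPolynomial σ K) :
    constantCoeff (algebraMap (MvPolynomial σ K) (MvPolynomial σ L) q) =
      algebraMap K L (constantCoeff q) := by
  rw [algebraMap_def]
  exact constantCoeff_map _ _

lemma coeff_mul_of_mem_pow_idealOfVars {σ R : Type*} [CommRing R] {d : ℕ} {p : MvPolynomial σ R}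
    (hp : p ∈ idealOfVars σ R ^ d) (q : MvPolynomial σ R) {e : σ →₀ ℕ} (he : e.degree = d) :
    coeff e (q * p) = constantCoeff q * coeff e p := by
  classical
  rw [coeff_mul, Finset.sum_eq_single (0, e)]
  · simp [constantCoeff_eq]
  · rintro ⟨a, b⟩ hab hne
    rw [Finset.HasAntidiagonal.mem_antidiagonal] at hab
    subst hab
    simp only [map_add] at he
    rw [(mem_pow_idealOfVars_iff' d p).1 hp b, mul_zero]
    have : a.degree ≠ 0 := fun h ↦ hne (by simp [(Finsupp.degree_eq_zero_iff a).1 h])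
    omega
  · simp

section

variable {K : Type*} (L : Type*) [Field K] [Field L] [Algebra K L] {n d : ℕ}
  {I J : Ideal (MvPolynomial (Fin n) K)}

/-- The coefficient of a monomial of minimal degree `d`, as a linear map on `I/J`. -/
noncomputable def initialCoeff (hI : I ≤ idealOfVars (Fin n) K ^ d)
    (hJ : J ≤ idealOfVars (Fin n) K ^ (d + 1)) {e : Fin n →₀ ℕ} (he : e.degree = d) :
    quotMod I J →ₗ[MvPolynomial (Fin n) K] MvPolynomial (Fin n) L ⧸ idealOfVars (Fin n) L :=
  Submodule.liftQ _
    { toFun := fun p ↦ Ideal.Quotient.mk _ (C (algebraMap K L (coeff e (p : MvPolynomial _ K))))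
      map_add' := by simp
      map_smul' := fun q p ↦ by
        rw [RingHom.id_apply, ← algebraMap_smul (MvPolynomial (Fin n) L) q (Ideal.Quotient.mk _ _)]
        refine Eq.trans ?_ (map_mul (Ideal.Quotient.mk (idealOfVars (Fin n) L)) _ _)
        rw [Ideal.Quotient.eq, mem_idealOfVars_iff]
        rw [map_sub, map_mul, constantCoeff_algebraMap, constantCoeff_C, constantCoeff_C,
          Submodule.coe_smul, smul_eq_mul, coeff_mul_of_mem_pow_idealOfVars (hI p.2) q he,
          map_mul, sub_self] }
    (fun p hp ↦ by
      have := (mem_pow_idealOfVars_iff' (d + 1) _).1 (hJ hp) e (by omega)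
      simp only [Submodule.subtype_apply] at this
      simp [this])

lemma initialCoeff_mk (hI : I ≤ idealOfVars (Fin n) K ^ d)
    (hJ : J ≤ idealOfVars (Fin n) K ^ (d + 1)) {e : Fin n →₀ ℕ} (he : e.degree = d) (p : I) :
    initialCoeff L hI hJ he (Submodule.Quotient.mk p) =
      Ideal.Quotient.mk _ (C (algebraMap K L (coeff e (p : MvPolynomial _ K)))) := rfl

end

open Classical in
/-- The class in `I/J` of a squarefree monomial, or `0` if the monomial is not in `I`. -/
noncomputable def sqClass {K : Type*} [Field K] {n : ℕ} (I J : Ideal (MvPolynomial (Fin n) K))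
    (T : Finset (Fin n)) : quotMod I J :=
  if h : sqm K T ∈ I then Submodule.Quotient.mk ⟨sqm K T, h⟩ else 0

section

variable {K : Type*} [Field K] {n : ℕ} {I J : Ideal (MvPolynomial (Fin n) K)}
  {T : Finset (Fin n)}

lemma sqm_insert {l : Fin n} (hl : l ∉ T) : sqm K (insert l T) = X l * sqm K T :=
  Finset.prod_insert hl

lemma sqClass_of_mem (h : sqm K T ∈ I) :
    sqClass I J T = Submodule.Quotient.mk ⟨sqm K T, h⟩ := dif_pos h

lemma sqClass_eq_zero (h : sqm K T ∈ J) : sqClass I J T = 0 := by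
  unfold sqClass
  split_ifs with hI
  · exact (Submodule.Quotient.mk_eq_zero _).2 h
  · rfl

lemma X_smul_sqClass (h : sqm K T ∈ I) {l : Fin n} (hl : l ∉ T) :
    (X l : MvPolynomial (Fin n) K) • sqClass I J T = sqClass I J (insert l T) := by
  have h' : sqm K (insert l T) ∈ I := sqm_insert (K := K) hl ▸ I.mul_mem_left _ h
  rw [sqClass_of_mem h, sqClass_of_mem h', ← Submodule.Quotient.mk_smul]
  congr 1
  exact Subtype.ext (sqm_insert hl).symm

end

instance flat_mvPolynomial_map {σ K L : Type*} [Field K] [Field L] [Algebra K L] :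
    Module.Flat (MvPolynomial σ K) (MvPolynomial σ L) :=
  Module.Flat.isBaseChange K (MvPolynomial σ K) L (MvPolynomial σ L) Algebra.IsPushout.out

/-- The length of a regular sequence on `I/J` is bounded by comparing `(I/J)_d` with `(I/J)_{d+1}`
after base change to an infinite field. -/
lemma length_mul_le_of_isRegular {K : Type*} [Field K] {n d r : ℕ} (hr : 0 < r)
    {I J : Ideal (MvPolynomial (Fin n) K)}
    (hI : I ≤ idealOfVars (Fin n) K ^ d) (hJ : J ≤ idealOfVars (Fin n) K ^ (d + 1))
    {f : Fin r → Finset (Fin n)} (hfinj : Function.Injective f) (hfd : ∀ i, (f i).card = d)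
    (hfI : ∀ i, sqm K (f i) ∈ I) {rs : List (MvPolynomial (Fin n) K)}
    (mem : ∀ p ∈ rs, p ∈ idealOfVars (Fin n) K)
    (reg : RingTheory.Sequence.IsWeaklyRegular (quotMod I J) rs) :
    rs.length * r ≤ r * d + (degSet I J (d + 1)).ncard := by
  classical
  let L := AlgebraicClosure K
  let R := MvPolynomial (Fin n) L
  let N := R ⊗[MvPolynomial (Fin n) K] quotMod I J
  let W : Submodule L R := Submodule.span L (Set.range X)
  have hW : Ideal.span (W : Set R) = idealOfVars (Fin n) L :=
    Submodule.span_span_of_tower L R _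
  let F (i : Fin r) : N := 1 ⊗ₜ sqClass I J (f i)
  have hdeg (i : Fin r) : (∑ j ∈ f i, Finsupp.single j 1 : Fin n →₀ ℕ).degree = d := by
    rw [degree_sum_single_one, hfd]
  let φ (i : Fin r) : N →ₗ[R] R ⧸ idealOfVars (Fin n) L :=
    (initialCoeff L hI hJ (hdeg i)).liftBaseChange R
  have hφF (i i' : Fin r) : φ i (F i') = Ideal.Quotient.mk _ (C (if i' = i then 1 else 0)) := by
    refine (LinearMap.liftBaseChange_tmul _ _ _ _).trans ?_
    rw [one_smul, sqClass_of_mem (hfI i'), initialCoeff_mk]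
    dsimp only
    rw [sqm_eq_monomial, coeff_monomial]
    have := (sum_single_one_injective n).comp hfinj |>.eq_iff (a := i') (b := i)
    by_cases h : i' = i <;> simp_all
  have hφ (i : Fin r) (x : N) (hx : x ∈ idealOfVars (Fin n) L • (⊤ : Submodule R N)) :
      φ i x = 0 := by
    refine Submodule.smul_induction_on hx (fun a ha y _ ↦ ?_) (fun x y hx hy ↦ ?_)
    · obtain ⟨b, hb⟩ := Ideal.Quotient.mk_surjective (φ i y)
      rw [map_smul, ← hb]
      exact Ideal.Quotient.eq_zero_iff_mem.2 (Ideal.mul_mem_right b _ ha)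
    · rw [map_add, hx, hy, add_zero]
  have hC (c : L) (hc : Ideal.Quotient.mk (idealOfVars (Fin n) L) (C c) = 0) : c = 0 := by
    simpa [Ideal.Quotient.eq_zero_iff_mem, mem_idealOfVars_iff] using hc
  have hN : Ideal.span (W : Set R) • (⊤ : Submodule R N) ≠ ⊤ := by
    intro h
    rw [hW] at h
    have := hφ ⟨0, hr⟩ (F ⟨0, hr⟩) (by rw [h]; exact Submodule.mem_top)
    rw [hφF] at this
    exact one_ne_zero (α := L) (by simpa using hC _ this)
  have memL (p : R) (hp : p ∈ rs.map (algebraMap _ R)) : p ∈ Ideal.span (W : Set R) := by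
    obtain ⟨q, hq, rfl⟩ := List.mem_map.1 hp
    have := (mem_idealOfVars_iff q).1 (mem q hq)
    rw [hW, mem_idealOfVars_iff]
    rw [constantCoeff_algebraMap, this, map_zero]
  obtain ⟨ws, hlen, hws, hreg⟩ := exists_isWeaklyRegular_mem_subspace W N _ memL
    (reg.of_flat_of_isBaseChange (TensorProduct.isBaseChange _ (quotMod I J) R)) hN
  rw [List.length_map] at hlen
  have hind : LinearIndependent L
      fun p : Fin ws.length × Fin r ↦ (ws.get p.1 • F p.2 : N) := by
    rw [Fintype.linearIndependent_iff]
    intro g hg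
    have hcoef (j : Fin ws.length)
        (h : ∑ i, g (j, i) • F i ∈ idealOfVars (Fin n) L • (⊤ : Submodule R N)) (i : Fin r) :
        g (j, i) = 0 := by
      have := hφ i _ h
      simp only [map_sum, LinearMap.map_smul_of_tower, hφF] at this
      rw [Finset.sum_eq_single i (by simp +contextual) (by simp)] at this
      rw [if_pos rfl, C_1, map_one] at this
      refine hC _ (Eq.trans ?_ this)
      exact Algebra.algebraMap_eq_smul_one (A := R ⧸ idealOfVars (Fin n) L) (g (j, i))
    have hzero := hreg.eq_zero_of_sum_smul_eq_zero (I := idealOfVars (Fin n) L)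
      (fun p hp ↦ hW ▸ Ideal.subset_span (hws p hp)) (fun j ↦ ∑ i, g (j, i) • F i)
      (fun j h ↦ Finset.sum_eq_zero fun i _ ↦ by
        rw [hcoef j h i]; exact zero_smul L (F i)) (by
        rw [← hg, Fintype.sum_prod_type]
        refine Finset.sum_congr rfl fun j _ ↦ ?_
        rw [Finset.smul_sum]
        exact Finset.sum_congr rfl fun i _ ↦ smul_comm _ _ _)
    rintro ⟨j, i⟩
    exact hcoef j (hzero j ▸ zero_mem _) i
  let B : Finset (Finset (Fin n)) := (degSet I J (d + 1)).toFinite.toFinset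
  let G : Finset N := (Finset.univ.sigma f).image (fun p ↦ (X p.2 : R) • F p.1) ∪
    B.image (fun T ↦ 1 ⊗ₜ sqClass I J T)
  have hX (l : Fin n) (i : Fin r) : (X l : R) • F i ∈ Submodule.span L (G : Set N) := by
    by_cases hl : l ∈ f i
    · refine Submodule.subset_span (Finset.mem_coe.2 (Finset.mem_union_left _ ?_))
      exact Finset.mem_image.2 ⟨⟨i, l⟩, by simpa using hl, rfl⟩
    · have hXF : (X l : R) • F i = 1 ⊗ₜ sqClass I J (insert l (f i)) := by
        have h : algebraMap (MvPolynomial (Fin n) K) R (X l) = X l := by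
          rw [algebraMap_def]
          exact map_X _ l
        rw [← X_smul_sqClass (hfI i) hl, TensorProduct.tmul_smul, ← h]
        exact algebraMap_smul R (X l) (F i)
      rw [hXF]
      by_cases hJ' : sqm K (insert l (f i)) ∈ J
      · rw [sqClass_eq_zero hJ', TensorProduct.tmul_zero]
        exact zero_mem _
      · refine Submodule.subset_span (Finset.mem_coe.2 (Finset.mem_union_right _ ?_))
        refine Finset.mem_image_of_mem _ ((Set.Finite.mem_toFinset _).2 ⟨⟨?_, hJ'⟩, ?_⟩)
        · exact sqm_insert (K := K) hl ▸ I.mul_mem_left _ (hfI i)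
        · rw [Finset.card_insert_of_notMem hl, hfd]
  have hspan : Set.range (fun p : Fin ws.length × Fin r ↦ (ws.get p.1 • F p.2 : N)) ≤
      Submodule.span L (G : Set N) := by
    rintro _ ⟨⟨j, i⟩, rfl⟩
    have hle : W ≤ (Submodule.span L (G : Set N)).comap
        ((LinearMap.toSpanSingleton R N (F i)).restrictScalars L) := by
      rw [Submodule.span_le]
      rintro _ ⟨l, rfl⟩
      exact hX l i
    exact hle (hws _ (List.get_mem _ _))
  have hcard := linearIndependent_le_span_aux' _ hind (G : Set N) hspan
  have hG : G.card ≤ r * d + B.card := by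
    refine (Finset.card_union_le _ _).trans (add_le_add (Finset.card_image_le.trans ?_)
      Finset.card_image_le)
    simp [hfd]
  have hB : B.card = (degSet I J (d + 1)).ncard := (Set.ncard_eq_toFinset_card _).symm
  simp only [Fintype.card_prod, Fintype.card_fin, Finset.coe_sort_coe, Fintype.card_coe] at hcard
  rw [← hlen, ← hB]
  exact hcard.trans hG

end BaseChange

/-- if `s < 2r` then `depth I/J ≤ d + 1`. -/
theorem statement11 {K : Type*} [Field K] {n : ℕ} (d : ℕ) (hd : 0 < d) (r : ℕ)
    (I J : Ideal (MvPolynomial (Fin n) K)) (hJI : J < I)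
    (f : Fin r → Finset (Fin n)) (hfinj : Function.Injective f)
    (hfd : ∀ i, (f i).card = d)
    (E : Set (Finset (Fin n))) (hE : ∀ T ∈ E, d + 1 ≤ T.card)
    (hI : I = Ideal.span (sqm K '' (Set.range f ∪ E)))
    (hmin : ∀ g ∈ Set.range f ∪ E,
      sqm K g ∉ Ideal.span (sqm K '' ((Set.range f ∪ E) \ {g})))
    (hJ : SqfreeGenFrom J (d + 1))
    (hsr : (degSet I J (d + 1)).ncard < 2 * r) :
    depthIJ I J ≤ d + 1 := by
  subst hI
  have hr : 0 < r := by omega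
  have hI : Ideal.span (sqm K '' (Set.range f ∪ E)) ≤ idealOfVars (Fin n) K ^ d := by
    refine span_sqm_le_pow_idealOfVars K ?_
    rintro T (⟨i, rfl⟩ | hT)
    · exact (hfd i).ge
    · exact (Nat.le_succ d).trans (hE T hT)
  obtain ⟨G, hG, rfl⟩ := hJ
  refine csSup_le' ?_
  rintro _ ⟨rs, rfl, mem, reg⟩
  have := length_mul_le_of_isRegular hr hI (span_sqm_le_pow_idealOfVars K hG) hfinj hfd
    (fun i ↦ Ideal.subset_span ⟨f i, .inl ⟨i, rfl⟩, rfl⟩) mem reg.toIsWeaklyRegular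
  by_contra! h
  have := Nat.mul_le_mul_right r (Nat.succ_le_of_lt h)
  nlinarith
end

section
/- Let n = 5, S = K[x_1,…,x_5], f_1 = x_1x_2, f_2 = x_1x_3, f_3 = x_1x_4, a = x_2x_3x_5, I = (f_1, f_2, f_3, a) and J = (x_4 a) = (x_2x_3x_4x_5). Then sdepth_S I/J = 3 and depth_S I/J = 3. -/
open MvPolynomial

namespace Koszul

section Operators

variable (R : Type*) [CommRing R] {n : ℕ}

/-- The sign of the position of `i` relative to `T`. -/
def sign (i : Fin n) (T : Finset (Fin n)) : R := (-1) ^ (T.filter (· < i)).card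

lemma sign_mul_self (i : Fin n) (T : Finset (Fin n)) : sign R i T * sign R i T = 1 := by
  rw [sign, ← mul_pow]; simp

lemma sign_insert {i j : Fin n} {T : Finset (Fin n)} (hj : j ∉ T) :
    sign R i (insert j T) = if j < i then -sign R i T else sign R i T := by
  unfold sign
  rw [Finset.filter_insert]
  split_ifs with h
  · rw [Finset.card_insert_of_notMem (by simp [hj]), pow_succ]; simp
  · rfl

variable (M : Type*) [AddCommGroup M] [Module R M]

/-- Contraction with the `i`-th coordinate on the exterior algebra with coefficients in `M`. -/
def contract (i : Fin n) : Module.End R (Finset (Fin n) → M) where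
  toFun f T := if i ∈ T then 0 else sign R i T • f (insert i T)
  map_add' f g := by ext T; by_cases h : i ∈ T <;> simp [h]
  map_smul' c f := by ext T; by_cases h : i ∈ T <;> simp [h, smul_comm c]

/-- Exterior multiplication by the `i`-th basis vector. -/
def wedge (i : Fin n) : Module.End R (Finset (Fin n) → M) where
  toFun f T := if i ∈ T then sign R i (T.erase i) • f (T.erase i) else 0
  map_add' f g := by ext T; by_cases h : i ∈ T <;> simp [h]
  map_smul' c f := by ext T; by_cases h : i ∈ T <;> simp [h, smul_comm c]

variable {M}

lemma contract_apply (i : Fin n) (f : Finset (Fin n) → M) (T : Finset (Fin n)) :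
    contract R M i f T = if i ∈ T then 0 else sign R i T • f (insert i T) := rfl

lemma wedge_apply (i : Fin n) (f : Finset (Fin n) → M) (T : Finset (Fin n)) :
    wedge R M i f T = if i ∈ T then sign R i (T.erase i) • f (T.erase i) else 0 := rfl

variable (M)

lemma contract_mul_self (i : Fin n) : contract R M i * contract R M i = 0 := by
  ext f T
  simp [contract_apply]

lemma contract_mul_contract (i j : Fin n) :
    contract R M i * contract R M j = -(contract R M j * contract R M i) := by
  rcases eq_or_ne i j with rfl | hij
  · simp [contract_mul_self]
  refine LinearMap.ext fun f => funext fun T => ?_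
  simp only [Module.End.mul_apply, LinearMap.neg_apply, Pi.neg_apply, contract_apply,
    Finset.mem_insert, hij, hij.symm, false_or]
  by_cases hi : i ∈ T <;> by_cases hj : j ∈ T <;> simp only [hi, hj, if_true, if_false,
    smul_zero, neg_zero]
  rw [sign_insert R hi, sign_insert R hj, Finset.insert_comm, smul_smul, smul_smul, ← neg_smul]
  congr 1
  rcases lt_or_gt_of_ne hij with h | h
  · simp [h, h.not_gt, mul_comm]
  · simp [h, h.not_gt, mul_comm]

lemma contract_mul_wedge_self (i : Fin n) :
    contract R M i * wedge R M i + wedge R M i * contract R M i = 1 := by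
  refine LinearMap.ext fun f => funext fun T => ?_
  simp only [Module.End.mul_apply, LinearMap.add_apply, Pi.add_apply, contract_apply,
    wedge_apply]
  by_cases hi : i ∈ T
  · simp [hi, smul_smul, sign_mul_self]
  · simp [hi, smul_smul, sign_mul_self]

lemma contract_mul_wedge {i j : Fin n} (hij : i ≠ j) :
    contract R M i * wedge R M j + wedge R M j * contract R M i = 0 := by
  refine LinearMap.ext fun f => funext fun T => ?_
  simp only [Module.End.mul_apply, LinearMap.add_apply, Pi.add_apply, contract_apply,
    wedge_apply, Finset.mem_insert, Finset.mem_erase, hij.symm, false_or]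
  by_cases hj : j ∈ T
  swap
  · simp [hj]
  obtain ⟨U, hU, rfl⟩ : ∃ U, j ∉ U ∧ T = insert j U :=
    ⟨T.erase j, by simp, (Finset.insert_erase hj).symm⟩
  by_cases hi : i ∈ U
  · simp [hi, hij]
  have h1 : (insert i (insert j U)).erase j = insert i U := by
    rw [Finset.insert_comm, Finset.erase_insert (by simp [hij.symm, hU])]
  simp only [hi, Finset.mem_insert_self, hij, Finset.mem_insert, or_false, if_false, if_true,
    h1, Finset.erase_insert hU, ne_eq, not_false_eq_true, and_false,
    LinearMap.zero_apply, Pi.zero_apply]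
  rw [sign_insert R hi, sign_insert R hU, smul_smul, smul_smul, ← add_smul]
  rcases lt_or_gt_of_ne hij with h | h
  · simp [h, h.not_gt, mul_comm]
  · simp [h, h.not_gt, mul_comm]

/-- The Koszul differential of `x` with coefficients in `M`. -/
def d (x : Fin n → R) : Module.End R (Finset (Fin n) → M) := ∑ i, x i • contract R M i

/-- The homotopy of the Koszul complex attached to `a`. -/
def homotopy (a : Fin n → R) : Module.End R (Finset (Fin n) → M) := ∑ i, a i • wedge R M i

variable {R}

lemma d_mul_d (x : Fin n → R) : d R M x * d R M x = 0 := by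
  simp only [d, Finset.sum_mul_sum]
  rw [← Finset.sum_product']
  refine Finset.sum_involution (fun p _ => (p.2, p.1)) ?_ ?_ (by simp) (by simp)
  · rintro ⟨i, j⟩ -
    simp only [smul_mul_smul_comm]
    rw [contract_mul_contract R M i j, mul_comm (x i)]
    simp
  · rintro ⟨i, j⟩ - h h'
    obtain rfl : j = i := congrArg Prod.fst h'
    simp [contract_mul_self] at h

lemma d_mul_homotopy (x a : Fin n → R) :
    d R M x * homotopy R M a + homotopy R M a * d R M x = (∑ i, a i * x i) • 1 := by
  simp only [d, homotopy, Finset.sum_mul_sum, Finset.sum_smul]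
  rw [Finset.sum_comm (f := fun i j => (a i • wedge R M i) * (x j • contract R M j)),
    ← Finset.sum_add_distrib]
  refine Finset.sum_congr rfl fun i _ => ?_
  rw [← Finset.sum_add_distrib, Finset.sum_eq_single i]
  · rw [smul_mul_smul_comm, smul_mul_smul_comm, mul_comm (x i), ← smul_add,
      contract_mul_wedge_self]
  · intro j _ hj
    rw [smul_mul_smul_comm, smul_mul_smul_comm, mul_comm (x i), ← smul_add,
      contract_mul_wedge R M hj.symm, smul_zero]
  · simp

variable {M}

lemma d_apply (x : Fin n → R) (f : Finset (Fin n) → M) (T : Finset (Fin n)) :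
    d R M x f T = ∑ i, x i • if i ∈ T then 0 else sign R i T • f (insert i T) := by
  simp [d, contract_apply]

lemma d_comp {N : Type*} [AddCommGroup N] [Module R N] (g : M →ₗ[R] N) (x : Fin n → R)
    (f : Finset (Fin n) → M) : d R N x (g ∘ f) = g ∘ d R M x f := by
  ext T
  simp only [d_apply, Function.comp_apply, map_sum, map_smul]
  refine Finset.sum_congr rfl fun i _ => ?_
  split_ifs <;> simp

lemma homotopy_support {a : Fin n → R} {f : Finset (Fin n) → M} {j : ℕ}
    (hf : ∀ T, f T ≠ 0 → T.card = j) (T : Finset (Fin n)) (hT : homotopy R M a f T ≠ 0) :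
    T.card = j + 1 := by
  contrapose! hT
  simp only [homotopy, LinearMap.sum_apply, LinearMap.smul_apply, Finset.sum_apply, Pi.smul_apply,
    wedge_apply]
  refine Finset.sum_eq_zero fun i _ => ?_
  split_ifs with hi
  · have : f (T.erase i) = 0 := by
      by_contra h
      have := hf _ h
      have := Finset.card_erase_add_one hi
      omega
    simp [this]
  · simp

end Operators

open RingTheory.Sequence in
/-- If `M` admits a weakly regular sequence of length `k` in the ideal generated by the `n`
elements `x`, then the Koszul homology of `M` vanishes in degrees above `n - k`. -/
theorem exists_eq_d_of_isWeaklyRegular {R : Type*} [CommRing R] {n : ℕ} (x : Fin n → R)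
    (rs : List R) (hx : ∀ r ∈ rs, r ∈ Ideal.span (Set.range x)) {M : Type*} [AddCommGroup M]
    [Module R M] (hrs : IsWeaklyRegular M rs) {j : ℕ} (hj : n < j + rs.length)
    {f : Finset (Fin n) → M} (hf : ∀ T, f T ≠ 0 → T.card = j) (hdf : d R M x f = 0) :
    ∃ v, f = d R M x v := by
  induction rs generalizing M j with
  | nil =>
    refine ⟨0, ?_⟩
    rw [map_zero]
    ext T
    by_contra h
    have := hf T h
    have := Finset.card_le_univ T
    simp at *
    omega
  | cons r rs ih =>
    rw [isWeaklyRegular_cons_iff] at hrs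
    obtain ⟨a, ha⟩ := Ideal.mem_span_range_iff_exists_fun.mp (hx r (by simp))
    have hr : d R M x (homotopy R M a f) = r • f := by
      have := LinearMap.congr_fun (d_mul_homotopy M x a) f
      simpa [hdf, ha] using this
    let q : M →ₗ[R] QuotSMulTop r M := Submodule.mkQ _
    obtain ⟨u, hu⟩ := ih (fun s hs => hx s (by simp [hs])) hrs.2 (j := j + 1)
      (by simp at hj; omega) (f := q ∘ homotopy R M a f)
      (fun T hT => homotopy_support hf T fun h => hT (by simp only [Function.comp_apply]; rw [h, map_zero]))
      (by
        rw [d_comp, hr]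
        ext T
        simp only [Function.comp_apply, Pi.smul_apply, Pi.zero_apply]
        exact (Submodule.Quotient.mk_eq_zero _).2
          (Submodule.smul_mem_pointwise_smul _ _ _ trivial))
    choose w hw using fun T => Submodule.mkQ_surjective _ (u T)
    have hv : ∀ T, ∃ v : M, homotopy R M a f T - d R M x w T = r • v := by
      intro T
      have h1 : u = q ∘ w := by ext T; exact (hw T).symm
      have h2 := congrFun hu T
      rw [h1, d_comp] at h2
      have h3 := (Submodule.Quotient.eq _).1 h2
      obtain ⟨v, -, hv⟩ := (Submodule.mem_smul_pointwise_iff_exists _ _ _).1 h3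
      exact ⟨v, hv.symm⟩
    choose v hv using hv
    refine ⟨v, ?_⟩
    have h1 : homotopy R M a f = d R M x w + r • v := by
      ext T
      simp [← hv T]
    rw [h1, map_add, map_smul] at hr
    have h2 : d R M x (d R M x w) = 0 := LinearMap.congr_fun (d_mul_d M x) w
    rw [h2, zero_add] at hr
    ext T
    exact hrs.1 (congrFun hr T).symm

end Koszul

open RingTheory.Sequence in
/-- Weak regularity of a sequence on the outer terms of a short exact sequence implies weak
regularity on the middle term. -/
theorem RingTheory.Sequence.IsWeaklyRegular.of_exact {R : Type*} [CommRing R] (rs : List R)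
    {M : Type*} {N : Type*} {P : Type*} [AddCommGroup M] [AddCommGroup N] [AddCommGroup P]
    [Module R M] [Module R N] [Module R P] {f : M →ₗ[R] N} {g : N →ₗ[R] P}
    (hf : Function.Injective f) (hfg : Function.Exact f g) (hg : Function.Surjective g)
    (hM : IsWeaklyRegular M rs) (hP : IsWeaklyRegular P rs) : IsWeaklyRegular N rs := by
  induction rs generalizing M N P with
  | nil => simp
  | cons r rs ih =>
    rw [isWeaklyRegular_cons_iff] at *
    refine ⟨isSMulRegular_of_range_eq_ker hf hfg.linearMap_ker_eq.symm hM.1 hP.1, ?_⟩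
    refine ih (f := QuotSMulTop.map r f) (g := QuotSMulTop.map r g) ?_
      (QuotSMulTop.map_exact r hfg hg) (QuotSMulTop.map_surjective r hg) hM.2 hP.2
    have h0 : Function.Exact (0 : M →ₗ[R] M) f := by
      intro y
      simp [(injective_iff_map_eq_zero' f).1 hf, eq_comm]
    have := QuotSMulTop.map_first_exact_on_four_term_exact_of_isSMulRegular_last h0 hfg hP.1
    rw [injective_iff_map_eq_zero]
    intro y hy
    obtain ⟨z, rfl⟩ := (this y).1 hy
    simp

section SquarefreePoset

variable {K : Type*} [Field K]

lemma sqm_mem_span_iff {n : ℕ} (G : Finset (Finset (Fin n))) (T : Finset (Fin n)) :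
    sqm K T ∈ Ideal.span (sqm K '' (G : Set (Finset (Fin n)))) ↔ ∃ U ∈ G, U ⊆ T := by
  constructor
  · intro h
    by_contra! hG
    let φ : MvPolynomial (Fin n) K →+* K := eval fun i => if i ∈ T then 1 else 0
    have hle : Ideal.span (sqm K '' (G : Set (Finset (Fin n)))) ≤ RingHom.ker φ := by
      rw [Ideal.span_le]
      rintro _ ⟨U, hU, rfl⟩
      obtain ⟨i, hi, hiT⟩ := Finset.not_subset.1 (hG U hU)
      simp only [SetLike.mem_coe, RingHom.mem_ker, φ, sqm, map_prod]
      exact Finset.prod_eq_zero hi (by simp [hiT])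
    have := hle h
    simp only [RingHom.mem_ker, φ, sqm, map_prod, eval_X] at this
    rw [Finset.prod_eq_one (fun i hi => by simp [hi])] at this
    exact one_ne_zero this
  · rintro ⟨U, hU, hUT⟩
    exact Ideal.mem_of_dvd _ (Finset.prod_dvd_prod_of_subset _ _ _ hUT)
      (Ideal.subset_span ⟨U, hU, rfl⟩)

/-- The supports of the squarefree monomials in `(x₁x₂, x₁x₃, x₁x₄, x₂x₃x₅) \ (x₂x₃x₄x₅)`. -/
def poset : Finset (Finset (Fin 5)) :=
  Finset.univ.filter fun T =>
    (∃ U ∈ ({{0, 1}, {0, 2}, {0, 3}, {1, 2, 4}} : Finset (Finset (Fin 5))), U ⊆ T) ∧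
      ¬ ∃ U ∈ ({{1, 2, 3, 4}} : Finset (Finset (Fin 5))), U ⊆ T

variable {I J : Ideal (MvPolynomial (Fin 5) K)}
    (hI : I = Ideal.span {X 0 * X 1, X 0 * X 2, X 0 * X 3, X 1 * X 2 * X 4})
    (hJ : J = Ideal.span {X 1 * X 2 * X 3 * X 4})

include hI hJ

lemma sqPoset_eq_poset : sqPoset I J = (poset : Set (Finset (Fin 5))) := by
  have hI' : I = Ideal.span (sqm K '' (({{0, 1}, {0, 2}, {0, 3}, {1, 2, 4}} :
      Finset (Finset (Fin 5))) : Set (Finset (Fin 5)))) := by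
    rw [hI]
    simp [Set.image_insert_eq, sqm, mul_assoc]
  have hJ' : J = Ideal.span (sqm K '' (({{1, 2, 3, 4}} :
      Finset (Finset (Fin 5))) : Set (Finset (Fin 5)))) := by
    rw [hJ]
    simp [sqm, mul_assoc]
  ext T
  simp only [sqPoset, Set.mem_ofPred_eq, poset, Finset.coe_filter, Finset.mem_univ, true_and]
  rw [hI', hJ', sqm_mem_span_iff, sqm_mem_span_iff]

lemma exists_isIntervalPartition :
    ∃ F, IsIntervalPartition I J F ∧ ∀ p ∈ F, 3 ≤ p.2.card := by
  refine ⟨{({0, 1}, {0, 1, 2}), ({0, 2}, {0, 2, 3}), ({0, 3}, {0, 1, 3}),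
    ({0, 1, 4}, {0, 1, 4}), ({0, 2, 4}, {0, 2, 4}), ({0, 3, 4}, {0, 3, 4}),
    ({1, 2, 4}, {1, 2, 4}), ({0, 1, 2, 3}, {0, 1, 2, 3}), ({0, 1, 2, 4}, {0, 1, 2, 4}),
    ({0, 1, 3, 4}, {0, 1, 3, 4}), ({0, 2, 3, 4}, {0, 2, 3, 4})}, ⟨?_, ?_⟩, by decide +kernel⟩
  · rw [sqPoset_eq_poset hI hJ]
    simp only [Finset.mem_coe]
    decide +kernel
  · rw [sqPoset_eq_poset hI hJ]
    simp only [Finset.mem_coe]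
    unfold ExistsUnique
    decide +kernel

lemma le_three_of_isIntervalPartition {F : Finset (Finset (Fin 5) × Finset (Fin 5))} {k : ℕ}
    (hF : IsIntervalPartition I J F) (hk : ∀ p ∈ F, k ≤ p.2.card) : k ≤ 3 := by
  by_contra! h
  obtain ⟨hF1, hF2⟩ := hF
  rw [sqPoset_eq_poset hI hJ] at hF1 hF2
  simp only [Finset.mem_coe] at hF1 hF2
  have hmin : ∀ T ∈ ({{0, 1}, {0, 2}, {0, 3}, {1, 2, 4}} : Finset (Finset (Fin 5))),
      T ∈ poset ∧ ∀ U ∈ poset, U ⊆ T → U = T := by decide +kernel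
  have hmax : ∀ V ∈ poset, 4 ≤ V.card → V ∈ ({{0, 1, 2, 3}, {0, 1, 2, 4}, {0, 1, 3, 4},
      {0, 2, 3, 4}} : Finset (Finset (Fin 5))) := by decide +kernel
  have hconv : ∀ T ∈ poset, ∀ V ∈ poset, ∀ W, T ⊆ W → W ⊆ V → W ∈ poset := by decide +kernel
  have hex : ∀ T ∈ ({{0, 1}, {0, 2}, {0, 3}, {1, 2, 4}} : Finset (Finset (Fin 5))),
      ∃ V ∈ ({{0, 1, 2, 3}, {0, 1, 2, 4}, {0, 1, 3, 4}, {0, 2, 3, 4}} :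
        Finset (Finset (Fin 5))), (T, V) ∈ F ∧ T ⊆ V := by
    intro T hT
    obtain ⟨⟨U, V⟩, ⟨hp, hUT, hTV⟩, -⟩ := hF2 T (hmin T hT).1
    obtain rfl := (hmin T hT).2 U (hF1 _ hp).1 hUT
    exact ⟨V, hmax V (hF1 _ hp).2.1 (h.trans_le (hk _ hp)), hp, hTV⟩
  have hdisj : ∀ T V T' V', (T, V) ∈ F → (T', V') ∈ F → T ≠ T' →
      T ∪ T' ⊆ V ∩ V' → False := by
    intro T V T' V' h1 h2 hne hsub
    have h3 := hF1 _ h1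
    have h4 : T ∪ T' ⊆ V := hsub.trans Finset.inter_subset_left
    have h5 := (hF2 (T ∪ T') (hconv T h3.1 V h3.2.1 _ Finset.subset_union_left h4)).unique
      ⟨h1, Finset.subset_union_left, h4⟩
      ⟨h2, Finset.subset_union_right, hsub.trans Finset.inter_subset_right⟩
    exact hne (congrArg Prod.fst h5)
  obtain ⟨V₁, m₁, p₁, s₁⟩ := hex {0, 1} (by decide)
  obtain ⟨V₂, m₂, p₂, s₂⟩ := hex {0, 2} (by decide)
  obtain ⟨V₃, m₃, p₃, s₃⟩ := hex {0, 3} (by decide)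
  obtain ⟨V₄, m₄, p₄, s₄⟩ := hex {1, 2, 4} (by decide)
  have h12 := hdisj _ _ _ _ p₁ p₂ (by decide)
  have h13 := hdisj _ _ _ _ p₁ p₃ (by decide)
  have h23 := hdisj _ _ _ _ p₂ p₃ (by decide)
  have h14 := hdisj _ _ _ _ p₁ p₄ (by decide)
  have h24 := hdisj _ _ _ _ p₂ p₄ (by decide)
  have key : ∀ V₁ ∈ ({{0, 1, 2, 3}, {0, 1, 2, 4}, {0, 1, 3, 4}, {0, 2, 3, 4}} :
        Finset (Finset (Fin 5))),
      ∀ V₂ ∈ ({{0, 1, 2, 3}, {0, 1, 2, 4}, {0, 1, 3, 4}, {0, 2, 3, 4}} :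
        Finset (Finset (Fin 5))),
      ∀ V₃ ∈ ({{0, 1, 2, 3}, {0, 1, 2, 4}, {0, 1, 3, 4}, {0, 2, 3, 4}} :
        Finset (Finset (Fin 5))),
      ∀ V₄ ∈ ({{0, 1, 2, 3}, {0, 1, 2, 4}, {0, 1, 3, 4}, {0, 2, 3, 4}} :
        Finset (Finset (Fin 5))),
      {0, 1} ⊆ V₁ ∧ {0, 2} ⊆ V₂ ∧ {0, 3} ⊆ V₃ ∧ {1, 2, 4} ⊆ V₄ →
      {0, 1} ∪ {0, 2} ⊆ V₁ ∩ V₂ ∨ {0, 1} ∪ {0, 3} ⊆ V₁ ∩ V₃ ∨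
        {0, 2} ∪ {0, 3} ⊆ V₂ ∩ V₃ ∨ {0, 1} ∪ {1, 2, 4} ⊆ V₁ ∩ V₄ ∨
        {0, 2} ∪ {1, 2, 4} ⊆ V₂ ∩ V₄ := by decide +kernel
  rcases key _ m₁ _ m₂ _ m₃ _ m₄ ⟨s₁, s₂, s₃, s₄⟩ with h | h | h | h | h
  exacts [h12 h, h13 h, h23 h, h14 h, h24 h]

theorem sdepth_eq_three : sdepth I J = 3 := by
  obtain ⟨F, hF, hk⟩ := exists_isIntervalPartition hI hJ
  refine le_antisymm (csSup_le ⟨3, F, hF, hk⟩ ?_) (le_csSup ⟨3, ?_⟩ ⟨F, hF, hk⟩) <;>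
  · rintro k ⟨F, hF, hk⟩
    exact le_three_of_isIntervalPartition hI hJ hF hk

end SquarefreePoset

section Depth

open RingTheory.Sequence

lemma isWeaklyRegular_quotient {R : Type*} [CommRing R] (L : Ideal R) (rs : List R)
    (h : ∀ k (hk : k < rs.length) (f : R),
      rs[k] * f ∈ L ⊔ Ideal.ofList (rs.take k) → f ∈ L ⊔ Ideal.ofList (rs.take k)) :
    IsWeaklyRegular (R ⧸ L) rs := by
  refine ⟨fun k hk => ?_⟩
  rw [isSMulRegular_quotient_iff_mem_of_smul_mem]
  have key : ∀ f : R, Submodule.mkQ L f ∈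
      (Ideal.ofList (rs.take k) • ⊤ : Submodule R (R ⧸ L)) ↔
        f ∈ L ⊔ Ideal.ofList (rs.take k) := by
    intro f
    have h1 : (Ideal.ofList (rs.take k) • ⊤ : Submodule R (R ⧸ L)) =
        Submodule.map (Submodule.mkQ L) (Ideal.ofList (rs.take k)) := by
      rw [← Submodule.range_mkQ L, ← Submodule.map_top, ← Submodule.map_smul'']
      simp
    rw [h1, ← Submodule.mem_comap, Submodule.comap_map_mkQ]
  intro x hx
  obtain ⟨f, rfl⟩ := Submodule.mkQ_surjective L x
  rw [← map_smul, key] at hx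
  exact (key f).2 (h k hk f hx)

lemma isWeaklyRegular_quotMod_of_colon {K : Type*} [Field K] {n : ℕ}
    {I L : Ideal (MvPolynomial (Fin n) K)} {s : Set (MvPolynomial (Fin n) K)}
    {g : MvPolynomial (Fin n) K} {rs : List (MvPolynomial (Fin n) K)} (hg : g ∈ I)
    (hsL : s ⊆ L) (hLs : ∀ f ∈ L, f * g ∈ Ideal.span s) (hreg : ∀ f, g * f ∈ L → f ∈ L)
    (hL : IsWeaklyRegular (MvPolynomial (Fin n) K ⧸ L) rs)
    (hrs : IsWeaklyRegular (quotMod I (Ideal.span (insert g s))) rs) :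
    IsWeaklyRegular (quotMod I (Ideal.span s)) rs := by
  let φ : MvPolynomial (Fin n) K →ₗ[MvPolynomial (Fin n) K] quotMod I (Ideal.span s) :=
    LinearMap.toSpanSingleton _ _ (Submodule.mkQ _ ⟨g, hg⟩)
  have hφ : ∀ f, φ f = Submodule.mkQ _ ⟨f * g, I.mul_mem_left f hg⟩ := fun f => rfl
  have hφ0 : ∀ f, φ f = 0 ↔ f * g ∈ Ideal.span s := by
    intro f
    rw [hφ, Submodule.mkQ_apply, Submodule.Quotient.mk_eq_zero]
    rfl
  have hker : LinearMap.ker φ = L := by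
    ext f
    rw [LinearMap.mem_ker, hφ0]
    exact ⟨fun h => hreg f (by rw [mul_comm]; exact Ideal.span_le.2 hsL h), hLs f⟩
  have hle : Ideal.span s ≤ Ideal.span (insert g s) := Ideal.span_mono (Set.subset_insert _ _)
  refine IsWeaklyRegular.of_exact rs (f := L.liftQ φ hker.ge)
    (g := Submodule.factor (Submodule.comap_mono hle))
    (LinearMap.ker_eq_bot.1 (Submodule.ker_liftQ_eq_bot _ _ _ hker.le)) ?_
    (Submodule.factor_surjective _) hL hrs
  intro y
  obtain ⟨⟨p, hp⟩, rfl⟩ := Submodule.mkQ_surjective _ y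
  have h1 : Submodule.factor (Submodule.comap_mono hle)
      (Submodule.mkQ (Submodule.comap I.subtype (Ideal.span s)) ⟨p, hp⟩) = 0 ↔
        p ∈ Ideal.span (insert g s) := by
    exact Submodule.Quotient.mk_eq_zero (Submodule.comap I.subtype (Ideal.span (insert g s)))
  rw [h1, Ideal.mem_span_insert]
  constructor
  · rintro ⟨f, z, hz, rfl⟩
    refine ⟨Submodule.mkQ L f, ?_⟩
    rw [Submodule.mkQ_apply, Submodule.liftQ_apply, hφ]
    refine (Submodule.Quotient.eq _).2 ?_
    simpa using hz
  · rintro ⟨q, hq⟩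
    obtain ⟨f, rfl⟩ := Submodule.mkQ_surjective _ q
    rw [Submodule.mkQ_apply, Submodule.liftQ_apply, hφ] at hq
    have h2 := (Submodule.Quotient.eq _).1 hq.symm
    exact ⟨f, p - f * g, by simpa using h2, by ring⟩

lemma mem_of_mul_mem_of_aeval {K σ : Type*} [Field K] {L : Ideal (MvPolynomial σ K)}
    (v : σ → MvPolynomial σ K) {h r : MvPolynomial σ K} (hv : ∀ i, X i - v i ∈ L) (hh : h ∈ L)
    (hL : L ≤ (Ideal.span {h}).comap (aeval v : MvPolynomial σ K →ₐ[K] MvPolynomial σ K))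
    (hr : ∀ f, h ∣ aeval v r * f → h ∣ f) (f : MvPolynomial σ K) (hf : r * f ∈ L) : f ∈ L := by
  have key : (Ideal.Quotient.mkₐ K L).comp (aeval v) = Ideal.Quotient.mkₐ K L := by
    ext i
    simpa using ((Ideal.Quotient.eq).2 (hv i)).symm
  have h1 : h ∣ aeval v f := by
    refine hr _ ?_
    rw [← map_mul]
    exact Ideal.mem_span_singleton.1 (hL hf)
  have h2 := Ideal.mem_of_dvd L h1 hh
  have h3 := AlgHom.congr_fun key f
  simp only [AlgHom.comp_apply, Ideal.Quotient.mkₐ_eq_mk] at h3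
  rw [← Ideal.Quotient.eq_zero_iff_mem] at h2 ⊢
  rw [← h3, h2]

lemma not_X_dvd {K σ : Type*} [Field K] {p : MvPolynomial σ K} {i : σ} (w : σ → K)
    (hw : w i = 0) (hp : eval w p ≠ 0) : ¬ X i ∣ p := by
  rintro ⟨q, rfl⟩
  simp [hw] at hp

lemma X_mul_X_dvd_of_dvd_mul {K σ : Type*} [Field K] {p f : MvPolynomial σ K} {i j : σ}
    (hi : ¬ X i ∣ p) (hj : ¬ X j ∣ p) (h : X i * X j ∣ p * f) : X i * X j ∣ f := by
  obtain ⟨f, rfl⟩ := ((X_prime (i := i)).dvd_or_dvd ((dvd_mul_right _ _).trans h)).resolve_left hi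
  refine mul_dvd_mul_left _ (((X_prime (i := j)).dvd_or_dvd ?_).resolve_left hj)
  rw [mul_left_comm] at h
  exact (mul_dvd_mul_iff_left (X_ne_zero i)).1 h

lemma mem_cube_of_mem_smul_top {K : Type*} [Field K] {n : ℕ}
    {I J : Ideal (MvPolynomial (Fin n) K)} (hI : I ≤ idealOfVars (Fin n) K ^ 2)
    (hJ : J ≤ idealOfVars (Fin n) K ^ 3) {p : MvPolynomial (Fin n) K} (hp : p ∈ I)
    (h : Submodule.mkQ (Submodule.comap I.subtype J) ⟨p, hp⟩ ∈
      (idealOfVars (Fin n) K • ⊤ : Submodule (MvPolynomial (Fin n) K) (quotMod I J))) :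
    p ∈ idealOfVars (Fin n) K ^ 3 := by
  have h1 : (idealOfVars (Fin n) K • ⊤ : Submodule (MvPolynomial (Fin n) K) (quotMod I J)) =
      (idealOfVars (Fin n) K • ⊤ : Submodule (MvPolynomial (Fin n) K) I).map
        (Submodule.mkQ (Submodule.comap I.subtype J)) := by
    rw [Submodule.map_smul'', Submodule.map_top, Submodule.range_mkQ]
  rw [h1, ← Submodule.mem_comap, Submodule.comap_map_mkQ] at h
  have h2 : Submodule.comap I.subtype J ⊔ idealOfVars (Fin n) K • ⊤ ≤
      Submodule.comap I.subtype (idealOfVars (Fin n) K ^ 3) := by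
    refine sup_le (Submodule.comap_mono hJ) (Submodule.smul_le.2 fun r hr q _ => ?_)
    change r * q.1 ∈ idealOfVars (Fin n) K ^ 3
    rw [pow_succ']
    exact Ideal.mul_mem_mul hr (hI q.2)
  exact h2 h

lemma X_mul_X_notMem_cube {K σ : Type*} [Field K] (i j : σ) :
    (X i * X j : MvPolynomial σ K) ∉ idealOfVars σ K ^ 3 := by
  have : (X i * X j : MvPolynomial σ K) =
      monomial (Finsupp.single i 1 + Finsupp.single j 1) 1 := by
    simp [X, monomial_mul]
  rw [this, monomial_mem_pow_idealOfVars_iff _ _ one_ne_zero]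
  simp

variable {K : Type*} [Field K]

/-- A maximal regular sequence. -/
noncomputable def regSeq (K : Type*) [Field K] : List (MvPolynomial (Fin 5) K) :=
  [X 0, X 3 - X 1, X 4 - X 2]

lemma isWeaklyRegular_regSeq_of_aeval {s : Set (MvPolynomial (Fin 5) K)}
    {h : MvPolynomial (Fin 5) K} (hh : h ∈ Ideal.span s)
    (H : ∀ k (hk : k < (regSeq K).length), ∃ v : Fin 5 → MvPolynomial (Fin 5) K,
      (∀ i, X i - v i ∈ Ideal.span s ⊔ Ideal.ofList ((regSeq K).take k)) ∧
      (∀ p ∈ s, h ∣ aeval v p) ∧ (∀ p ∈ (regSeq K).take k, h ∣ aeval v p) ∧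
      ∀ f, h ∣ aeval v (regSeq K)[k] * f → h ∣ f) :
    IsWeaklyRegular (MvPolynomial (Fin 5) K ⧸ Ideal.span s) (regSeq K) := by
  refine isWeaklyRegular_quotient _ _ fun k hk => ?_
  obtain ⟨v, hv, hs, hl, hr⟩ := H k hk
  refine mem_of_mul_mem_of_aeval v hv (Ideal.mem_sup_left hh) (sup_le ?_ ?_) hr
  · exact Ideal.span_le.2 fun p hp => Ideal.mem_span_singleton.2 (hs p hp)
  · exact Ideal.span_le.2 fun p hp => Ideal.mem_span_singleton.2 (hl p hp)

lemma X_four_sub_X_two_ne_zero : (X 4 - X 2 : MvPolynomial (Fin 5) K) ≠ 0 :=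
  sub_ne_zero.2 fun h => by simpa using X_injective h

lemma isWeaklyRegular_regSeq_X_three :
    IsWeaklyRegular (MvPolynomial (Fin 5) K ⧸
      (Ideal.span {X 3} : Ideal (MvPolynomial (Fin 5) K))) (regSeq K) := by
  refine isWeaklyRegular_regSeq_of_aeval (h := 0) (zero_mem _) fun k hk => ?_
  obtain ⟨L, hL⟩ : ∃ L, L = (Ideal.span {X 3} : Ideal (MvPolynomial (Fin 5) K)) ⊔
    Ideal.ofList ((regSeq K).take k) := ⟨_, rfl⟩
  have h3 : X 3 ∈ L := hL ▸ Ideal.mem_sup_left (Ideal.subset_span rfl)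
  have hl : ∀ p ∈ (regSeq K).take k, p ∈ L :=
    fun p hp => hL ▸ Ideal.mem_sup_right (Ideal.subset_span hp)
  rw [← hL]
  clear hL
  simp only [regSeq, List.length_cons, List.length_nil] at hk
  interval_cases k
  · refine ⟨![X 0, X 1, X 2, 0, X 4], ?_, by simp, by simp, by simp [regSeq]⟩
    simp [Fin.forall_fin_succ, h3]
  · have h0 : X 0 ∈ L := hl _ (by simp [regSeq])
    refine ⟨![0, X 1, X 2, 0, X 4], ?_, by simp, by simp [regSeq], by simp [regSeq]⟩
    simp [Fin.forall_fin_succ, h3, h0]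
  · have h0 : X 0 ∈ L := hl _ (by simp [regSeq])
    have h1 : X 1 ∈ L := by
      rw [← sub_sub_cancel (X 3) (X 1)]
      exact sub_mem h3 (hl _ (by simp [regSeq]))
    refine ⟨![0, 0, X 2, 0, X 4], ?_, by simp, by simp [regSeq],
      by simp [regSeq, X_four_sub_X_two_ne_zero]⟩
    simp [Fin.forall_fin_succ, h3, h0, h1]

lemma isWeaklyRegular_regSeq_X_one :
    IsWeaklyRegular (MvPolynomial (Fin 5) K ⧸
      (Ideal.span {X 1} : Ideal (MvPolynomial (Fin 5) K))) (regSeq K) := by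
  refine isWeaklyRegular_regSeq_of_aeval (h := 0) (zero_mem _) fun k hk => ?_
  obtain ⟨L, hL⟩ : ∃ L, L = (Ideal.span {X 1} : Ideal (MvPolynomial (Fin 5) K)) ⊔
    Ideal.ofList ((regSeq K).take k) := ⟨_, rfl⟩
  have h1 : X 1 ∈ L := hL ▸ Ideal.mem_sup_left (Ideal.subset_span rfl)
  have hl : ∀ p ∈ (regSeq K).take k, p ∈ L :=
    fun p hp => hL ▸ Ideal.mem_sup_right (Ideal.subset_span hp)
  rw [← hL]
  clear hL
  simp only [regSeq, List.length_cons, List.length_nil] at hk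
  interval_cases k
  · refine ⟨![X 0, 0, X 2, X 3, X 4], ?_, by simp, by simp, by simp [regSeq]⟩
    simp [Fin.forall_fin_succ, h1]
  · have h0 : X 0 ∈ L := hl _ (by simp [regSeq])
    refine ⟨![0, 0, X 2, X 3, X 4], ?_, by simp, by simp [regSeq], by simp [regSeq]⟩
    simp [Fin.forall_fin_succ, h1, h0]
  · have h0 : X 0 ∈ L := hl _ (by simp [regSeq])
    have h3 : X 3 ∈ L := by
      rw [← sub_add_cancel (X 3) (X 1)]
      exact add_mem (hl _ (by simp [regSeq])) h1
    refine ⟨![0, 0, X 2, 0, X 4], ?_, by simp, by simp [regSeq],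
      by simp [regSeq, X_four_sub_X_two_ne_zero]⟩
    simp [Fin.forall_fin_succ, h3, h0, h1]

lemma isWeaklyRegular_regSeq_X_one_X_two :
    IsWeaklyRegular (MvPolynomial (Fin 5) K ⧸
      (Ideal.span {X 1, X 2} : Ideal (MvPolynomial (Fin 5) K))) (regSeq K) := by
  refine isWeaklyRegular_regSeq_of_aeval (h := 0) (zero_mem _) fun k hk => ?_
  obtain ⟨L, hL⟩ : ∃ L, L = (Ideal.span {X 1, X 2} : Ideal (MvPolynomial (Fin 5) K)) ⊔
    Ideal.ofList ((regSeq K).take k) := ⟨_, rfl⟩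
  have h1 : X 1 ∈ L := hL ▸ Ideal.mem_sup_left (Ideal.subset_span (by simp))
  have h2 : X 2 ∈ L := hL ▸ Ideal.mem_sup_left (Ideal.subset_span (by simp))
  have hl : ∀ p ∈ (regSeq K).take k, p ∈ L :=
    fun p hp => hL ▸ Ideal.mem_sup_right (Ideal.subset_span hp)
  rw [← hL]
  clear hL
  simp only [regSeq, List.length_cons, List.length_nil] at hk
  interval_cases k
  · refine ⟨![X 0, 0, 0, X 3, X 4], ?_, by simp, by simp, by simp [regSeq]⟩
    simp [Fin.forall_fin_succ, h1, h2]
  · have h0 : X 0 ∈ L := hl _ (by simp [regSeq])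
    refine ⟨![0, 0, 0, X 3, X 4], ?_, by simp, by simp [regSeq], by simp [regSeq]⟩
    simp [Fin.forall_fin_succ, h1, h2, h0]
  · have h0 : X 0 ∈ L := hl _ (by simp [regSeq])
    have h3 : X 3 ∈ L := by
      rw [← sub_add_cancel (X 3) (X 1)]
      exact add_mem (hl _ (by simp [regSeq])) h1
    refine ⟨![0, 0, 0, 0, X 4], ?_, by simp, by simp [regSeq], by simp [regSeq]⟩
    simp [Fin.forall_fin_succ, h3, h0, h1, h2]

lemma isWeaklyRegular_regSeq_X_two_mul_X_four :
    IsWeaklyRegular (MvPolynomial (Fin 5) K ⧸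
      (Ideal.span {X 2 * X 4} : Ideal (MvPolynomial (Fin 5) K))) (regSeq K) := by
  refine isWeaklyRegular_regSeq_of_aeval (h := X 2 * X 4) (Ideal.subset_span rfl) fun k hk => ?_
  obtain ⟨L, hL⟩ : ∃ L, L = (Ideal.span {X 2 * X 4} : Ideal (MvPolynomial (Fin 5) K)) ⊔
    Ideal.ofList ((regSeq K).take k) := ⟨_, rfl⟩
  have hl : ∀ p ∈ (regSeq K).take k, p ∈ L :=
    fun p hp => hL ▸ Ideal.mem_sup_right (Ideal.subset_span hp)
  rw [← hL]
  clear hL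
  simp only [regSeq, List.length_cons, List.length_nil] at hk
  interval_cases k
  · refine ⟨X, by simp, by simp, by simp, fun f => X_mul_X_dvd_of_dvd_mul ?_ ?_⟩ <;>
      exact not_X_dvd (fun i => if i = 0 then 1 else 0) (by simp) (by simp [regSeq])
  · have h0 : X 0 ∈ L := hl _ (by simp [regSeq])
    refine ⟨![0, X 1, X 2, X 3, X 4], ?_, by simp, by simp [regSeq],
      fun f => X_mul_X_dvd_of_dvd_mul ?_ ?_⟩
    · simp [Fin.forall_fin_succ, h0]
    all_goals
      exact not_X_dvd (fun i => if i = 3 then 1 else 0) (by simp) (by simp [regSeq])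
  · have h0 : X 0 ∈ L := hl _ (by simp [regSeq])
    have h31 : X 3 - X 1 ∈ L := hl _ (by simp [regSeq])
    refine ⟨![0, X 1, X 2, X 1, X 4], ?_, by simp, by simp [regSeq],
      fun f => X_mul_X_dvd_of_dvd_mul ?_ ?_⟩
    · simp [Fin.forall_fin_succ, h0, h31]
    · exact not_X_dvd (fun i => if i = 4 then 1 else 0) (by simp) (by simp [regSeq])
    · exact not_X_dvd (fun i => if i = 2 then 1 else 0) (by simp) (by simp [regSeq])

lemma mem_idealOfVars_of_mem_regSeq {r : MvPolynomial (Fin 5) K} (hr : r ∈ regSeq K) :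
    r ∈ idealOfVars (Fin 5) K := by
  have hX : ∀ i, (X i : MvPolynomial (Fin 5) K) ∈ idealOfVars (Fin 5) K :=
    fun i => Ideal.subset_span ⟨i, rfl⟩
  simp only [regSeq, List.mem_cons, List.not_mem_nil, or_false] at hr
  rcases hr with rfl | rfl | rfl
  exacts [hX _, sub_mem (hX _) (hX _), sub_mem (hX _) (hX _)]

/-- The Koszul chain `x₀ · e₁₂₃`. -/
noncomputable def koszulChain (K : Type*) [Field K] (T : Finset (Fin 5)) :
    MvPolynomial (Fin 5) K :=
  if T = {1, 2, 3} then X 0 else 0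

lemma d_koszulChain_mem {I : Ideal (MvPolynomial (Fin 5) K)}
    (hI : I = Ideal.span {X 0 * X 1, X 0 * X 2, X 0 * X 3, X 1 * X 2 * X 4})
    (T : Finset (Fin 5)) :
    Koszul.d (MvPolynomial (Fin 5) K) (MvPolynomial (Fin 5) K) X (koszulChain K) T ∈ I := by
  rw [Koszul.d_apply]
  refine sum_mem fun i _ => ?_
  by_cases hi : i ∉ T ∧ insert i T = {1, 2, 3}
  · have hi' : i = 1 ∨ i = 2 ∨ i = 3 := by
      simpa [hi.2] using Finset.mem_insert_self i T
    have hmem : X i * X 0 ∈ I := by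
      rw [hI, mul_comm (X i) (X 0)]
      rcases hi' with rfl | rfl | rfl <;> exact Ideal.subset_span (by simp)
    rw [if_neg hi.1, koszulChain, if_pos hi.2, smul_eq_mul, smul_eq_mul, mul_left_comm]
    exact I.mul_mem_left _ hmem
  · rw [not_and_or, not_not] at hi
    rcases hi with hi | hi
    · rw [if_pos hi, smul_zero]
      exact zero_mem _
    · rw [koszulChain, if_neg hi, smul_zero, ite_self, smul_zero]
      exact zero_mem _

lemma card_eq_two_of_d_koszulChain_ne_zero {T : Finset (Fin 5)}
    (hT : Koszul.d (MvPolynomial (Fin 5) K) (MvPolynomial (Fin 5) K) X (koszulChain K) T ≠ 0) :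
    T.card = 2 := by
  contrapose! hT
  rw [Koszul.d_apply]
  refine Finset.sum_eq_zero fun i _ => ?_
  by_cases hi : i ∈ T
  · rw [if_pos hi, smul_zero]
  · have : insert i T ≠ {1, 2, 3} := by
      intro h'
      have := congrArg Finset.card h'
      rw [Finset.card_insert_of_notMem hi] at this
      simp at this
      omega
    rw [koszulChain, if_neg this, smul_zero, ite_self, smul_zero]

lemma d_koszulChain_apply :
    Koszul.d (MvPolynomial (Fin 5) K) (MvPolynomial (Fin 5) K) X (koszulChain K) {1, 2} =
      Koszul.sign (MvPolynomial (Fin 5) K) (3 : Fin 5) {1, 2} * (X 3 * X 0) := by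
  have h1 : (3 : Fin 5) ∉ ({1, 2} : Finset (Fin 5)) := by decide
  have h2 : insert (3 : Fin 5) {1, 2} = ({1, 2, 3} : Finset (Fin 5)) := by decide
  have h3 : ∀ i : Fin 5, i ≠ 3 →
      i ∈ ({1, 2} : Finset (Fin 5)) ∨ insert i {1, 2} ≠ ({1, 2, 3} : Finset (Fin 5)) := by
    decide
  rw [Koszul.d_apply, Finset.sum_eq_single 3]
  · rw [if_neg h1, koszulChain, if_pos h2, smul_eq_mul, smul_eq_mul, mul_left_comm]
  · intro i _ hi
    rcases h3 i hi with h' | h'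
    · rw [if_pos h', smul_zero]
    · rw [koszulChain, if_neg h', smul_zero, ite_self, smul_zero]
  · exact fun h => absurd (Finset.mem_univ _) h

lemma d_d_koszulChain :
    Koszul.d (MvPolynomial (Fin 5) K) (MvPolynomial (Fin 5) K) X
      (Koszul.d (MvPolynomial (Fin 5) K) (MvPolynomial (Fin 5) K) X (koszulChain K)) = 0 := by
  have h := Koszul.d_mul_d (M := MvPolynomial (Fin 5) K) (X (R := K) (σ := Fin 5))
  rw [← Module.End.mul_apply, h, LinearMap.zero_apply]

variable {I J : Ideal (MvPolynomial (Fin 5) K)}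
    (hI : I = Ideal.span {X 0 * X 1, X 0 * X 2, X 0 * X 3, X 1 * X 2 * X 4})
    (hJ : J = Ideal.span {X 1 * X 2 * X 3 * X 4})

include hI hJ

lemma isWeaklyRegular_regSeq : IsWeaklyRegular (quotMod I J) (regSeq K) := by
  have hgen : X 0 * X 1 ∈ I ∧ X 0 * X 2 ∈ I ∧ X 0 * X 3 ∈ I ∧ X 1 * X 2 * X 4 ∈ I := by
    rw [hI]
    refine ⟨?_, ?_, ?_, ?_⟩ <;> exact Ideal.subset_span (by simp)
  obtain ⟨m1, m2, m3, m4⟩ := hgen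
  rw [hJ]
  refine isWeaklyRegular_quotMod_of_colon (L := Ideal.span {X 3}) m4 ?_ ?_ ?_
    isWeaklyRegular_regSeq_X_three ?_
  · rintro _ rfl
    exact Ideal.mem_span_singleton.2 ⟨X 1 * X 2 * X 4, by ring⟩
  · intro f hf
    obtain ⟨q, rfl⟩ := Ideal.mem_span_singleton.1 hf
    exact Ideal.mem_span_singleton.2 ⟨q, by ring⟩
  · refine mem_of_mul_mem_of_aeval ![X 0, X 1, X 2, 0, X 4] (h := 0) ?_ (zero_mem _) ?_ ?_
    · simp [Fin.forall_fin_succ, Ideal.mem_span_singleton]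
    · simp [Ideal.span_le]
    · simp
  refine isWeaklyRegular_quotMod_of_colon (L := Ideal.span {X 2 * X 4}) m1 ?_ ?_ ?_
    isWeaklyRegular_regSeq_X_two_mul_X_four ?_
  · rintro _ (rfl | rfl)
    · exact Ideal.mem_span_singleton.2 ⟨X 1, by ring⟩
    · exact Ideal.mem_span_singleton.2 ⟨X 1 * X 3, by ring⟩
  · intro f hf
    obtain ⟨q, rfl⟩ := Ideal.mem_span_singleton.1 hf
    exact Ideal.mem_of_dvd _ ⟨q * X 0, by ring⟩
      (Ideal.subset_span (show X 1 * X 2 * X 4 ∈ _ by simp))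
  · intro f hf
    rw [Ideal.mem_span_singleton] at hf ⊢
    refine X_mul_X_dvd_of_dvd_mul ?_ ?_ hf <;>
      exact not_X_dvd (fun i => if i = 0 ∨ i = 1 then 1 else 0) (by simp) (by simp)
  refine isWeaklyRegular_quotMod_of_colon (L := Ideal.span {X 1}) m2 ?_ ?_ ?_
    isWeaklyRegular_regSeq_X_one ?_
  · rintro _ (rfl | rfl | rfl) <;> rw [SetLike.mem_coe, Ideal.mem_span_singleton]
    · exact ⟨X 0, by ring⟩
    · exact ⟨X 2 * X 4, by ring⟩
    · exact ⟨X 2 * X 3 * X 4, by ring⟩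
  · intro f hf
    obtain ⟨q, rfl⟩ := Ideal.mem_span_singleton.1 hf
    exact Ideal.mem_of_dvd _ ⟨q * X 2, by ring⟩
      (Ideal.subset_span (show X 0 * X 1 ∈ _ by simp))
  · refine mem_of_mul_mem_of_aeval ![X 0, 0, X 2, X 3, X 4] (h := 0) ?_ (zero_mem _) ?_ ?_
    · simp [Fin.forall_fin_succ, Ideal.mem_span_singleton]
    · simp [Ideal.span_le]
    · simp
  refine isWeaklyRegular_quotMod_of_colon (L := Ideal.span {X 1, X 2}) m3 ?_ ?_ ?_
    isWeaklyRegular_regSeq_X_one_X_two ?_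
  · have h1 : X 1 ∈ (Ideal.span {X 1, X 2} : Ideal (MvPolynomial (Fin 5) K)) :=
      Ideal.subset_span (by simp)
    have h2 : X 2 ∈ (Ideal.span {X 1, X 2} : Ideal (MvPolynomial (Fin 5) K)) :=
      Ideal.subset_span (by simp)
    rintro _ (rfl | rfl | rfl | rfl)
    · exact Ideal.mul_mem_left _ _ h2
    · exact Ideal.mul_mem_left _ _ h1
    · exact Ideal.mul_mem_right _ _ (Ideal.mul_mem_left _ _ h2)
    · exact Ideal.mul_mem_right _ _ (Ideal.mul_mem_right _ _ (Ideal.mul_mem_left _ _ h2))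
  · intro f hf
    obtain ⟨a, b, rfl⟩ := Ideal.mem_span_pair.1 hf
    rw [show (a * X 1 + b * X 2) * (X 0 * X 3) =
      a * X 3 * (X 0 * X 1) + b * X 3 * (X 0 * X 2) by ring]
    exact add_mem (Ideal.mul_mem_left _ _ (Ideal.subset_span (by simp)))
      (Ideal.mul_mem_left _ _ (Ideal.subset_span (by simp)))
  · refine mem_of_mul_mem_of_aeval ![X 0, 0, 0, X 3, X 4] (h := 0) ?_ (zero_mem _) ?_ ?_
    · have h1 : X 1 ∈ (Ideal.span {X 1, X 2} : Ideal (MvPolynomial (Fin 5) K)) :=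
        Ideal.subset_span (by simp)
      have h2 : X 2 ∈ (Ideal.span {X 1, X 2} : Ideal (MvPolynomial (Fin 5) K)) :=
        Ideal.subset_span (by simp)
      simp [Fin.forall_fin_succ, h1, h2]
    · simp [Ideal.span_le, Set.insert_subset_iff]
    · simp
  have htop : (Submodule.comap I.subtype (Ideal.span {X 0 * X 3, X 0 * X 2, X 0 * X 1,
      X 1 * X 2 * X 4, X 1 * X 2 * X 3 * X 4})) = ⊤ := by
    rw [Submodule.comap_subtype_eq_top, hI]
    refine Ideal.span_mono ?_
    rintro _ (rfl | rfl | rfl | rfl) <;> simp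
  have : Subsingleton (quotMod I (Ideal.span {X 0 * X 3, X 0 * X 2, X 0 * X 1,
      X 1 * X 2 * X 4, X 1 * X 2 * X 3 * X 4})) := Submodule.Quotient.subsingleton_iff.2 htop
  exact ⟨fun i hi a b _ => by
    obtain ⟨a, rfl⟩ := Submodule.mkQ_surjective _ a
    obtain ⟨b, rfl⟩ := Submodule.mkQ_surjective _ b
    rw [Subsingleton.elim a b]⟩

lemma le_pow_idealOfVars :
    I ≤ idealOfVars (Fin 5) K ^ 2 ∧ J ≤ idealOfVars (Fin 5) K ^ 3 := by
  have hX : ∀ i, (X i : MvPolynomial (Fin 5) K) ∈ idealOfVars (Fin 5) K :=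
    fun i => Ideal.subset_span ⟨i, rfl⟩
  have h2 : ∀ i j, (X i * X j : MvPolynomial (Fin 5) K) ∈ idealOfVars (Fin 5) K ^ 2 :=
    fun i j => by rw [pow_two]; exact Ideal.mul_mem_mul (hX i) (hX j)
  have h3 : ∀ i j k,
      (X i * X j * X k : MvPolynomial (Fin 5) K) ∈ idealOfVars (Fin 5) K ^ 3 :=
    fun i j k => by rw [pow_succ]; exact Ideal.mul_mem_mul (h2 i j) (hX k)
  rw [hI, hJ, Ideal.span_le, Ideal.span_le]
  constructor
  · rintro _ (rfl | rfl | rfl | rfl)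
    · exact h2 _ _
    · exact h2 _ _
    · exact h2 _ _
    · exact Ideal.mul_mem_right _ _ (h2 _ _)
  · rintro _ rfl
    exact Ideal.mul_mem_right _ _ (h3 _ _ _)

lemma isRegular_regSeq : IsRegular (quotMod I J) (regSeq K) := by
  refine ⟨isWeaklyRegular_regSeq hI hJ, fun h => ?_⟩
  obtain ⟨hI2, hJ3⟩ := le_pow_idealOfVars hI hJ
  have hle : Ideal.ofList (regSeq K) ≤ idealOfVars (Fin 5) K :=
    Ideal.span_le.2 fun _ => mem_idealOfVars_of_mem_regSeq
  have hm : X 0 * X 1 ∈ I := hI ▸ Ideal.subset_span (by simp)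
  refine X_mul_X_notMem_cube 0 1 (mem_cube_of_mem_smul_top hI2 hJ3 hm ?_)
  exact Submodule.smul_mono_left hle (h ▸ Submodule.mem_top)

lemma length_le_three_of_isWeaklyRegular {rs : List (MvPolynomial (Fin 5) K)}
    (hrs : ∀ r ∈ rs, r ∈ idealOfVars (Fin 5) K) (h : IsWeaklyRegular (quotMod I J) rs) :
    rs.length ≤ 3 := by
  by_contra! hlt
  obtain ⟨hI2, hJ3⟩ := le_pow_idealOfVars hI hJ
  obtain ⟨c, hc, hcard, hdc, hc12⟩ : ∃ c : Finset (Fin 5) → MvPolynomial (Fin 5) K,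
      (∀ T, c T ∈ I) ∧ (∀ T, c T ≠ 0 → T.card = 2) ∧
      Koszul.d (MvPolynomial (Fin 5) K) (MvPolynomial (Fin 5) K) X c = 0 ∧
      c {1, 2} = Koszul.sign (MvPolynomial (Fin 5) K) (3 : Fin 5) {1, 2} * (X 3 * X 0) :=
    ⟨_, d_koszulChain_mem hI, fun _ => card_eq_two_of_d_koszulChain_ne_zero,
      d_d_koszulChain, d_koszulChain_apply⟩
  have hdc' : Koszul.d (MvPolynomial (Fin 5) K) I X (fun T => ⟨c T, hc T⟩) = 0 := by
    have h1 : I.subtype ∘ Koszul.d (MvPolynomial (Fin 5) K) I X (fun T => ⟨c T, hc T⟩) = 0 := by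
      rw [← Koszul.d_comp]
      exact hdc
    exact funext fun T => Subtype.ext (congrFun h1 T)
  obtain ⟨v, hv⟩ := Koszul.exists_eq_d_of_isWeaklyRegular X rs hrs h (j := 2) (by omega)
    (f := Submodule.mkQ (Submodule.comap I.subtype J) ∘ fun T => ⟨c T, hc T⟩)
    (fun T hT => hcard T fun h0 => hT (by
      have : (⟨c T, hc T⟩ : I) = 0 := Subtype.ext h0
      simp only [Function.comp_apply]
      rw [this, map_zero]))
    (by
      rw [Koszul.d_comp, hdc']
      ext T
      exact map_zero _)
  have hmem : c {1, 2} ∈ idealOfVars (Fin 5) K ^ 3 := by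
    refine mem_cube_of_mem_smul_top hI2 hJ3 (hc _) ?_
    have := congrFun hv {1, 2}
    simp only [Function.comp_apply] at this
    rw [this, Koszul.d_apply]
    exact sum_mem fun i _ => Submodule.smul_mem_smul (Ideal.subset_span ⟨i, rfl⟩) trivial
  have := (idealOfVars (Fin 5) K ^ 3).mul_mem_left (Koszul.sign _ (3 : Fin 5) {1, 2}) hmem
  rw [hc12, ← mul_assoc, Koszul.sign_mul_self, one_mul] at this
  exact X_mul_X_notMem_cube _ _ this

theorem depthIJ_eq_three : depthIJ I J = 3 := by
  have hreg := isRegular_regSeq hI hJ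
  refine le_antisymm
    (csSup_le ⟨3, regSeq K, rfl, fun _ => mem_idealOfVars_of_mem_regSeq, hreg⟩ ?_)
    (le_csSup ⟨3, ?_⟩ ⟨regSeq K, rfl, fun _ => mem_idealOfVars_of_mem_regSeq, hreg⟩) <;>
  · rintro _ ⟨rs, rfl, hrs, hreg⟩
    exact length_le_three_of_isWeaklyRegular hI hJ hrs hreg.toIsWeaklyRegular

end Depth

/-- for `I = (x₁x₂, x₁x₃, x₁x₄, x₂x₃x₅)` and `J = (x₂x₃x₄x₅)` in
`K[x₁,…,x₅]`, one has `sdepth I/J = 3` and `depth I/J = 3`. -/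
theorem statement15 {K : Type*} [Field K]
    (I J : Ideal (MvPolynomial (Fin 5) K))
    (hI : I = Ideal.span {X 0 * X 1, X 0 * X 2, X 0 * X 3, X 1 * X 2 * X 4})
    (hJ : J = Ideal.span {X 1 * X 2 * X 3 * X 4}) :
    sdepth I J = 3 ∧ depthIJ I J = 3 := by
  exact ⟨sdepth_eq_three hI hJ, depthIJ_eq_three hI hJ⟩
end

section
/- Let n = 5, S = K[x_1,…,x_5], I = (x_1x_2, x_1x_3, x_2x_3, x_1x_4, x_3x_5) and J = (x_1x_2x_5, x_1x_4x_5, x_2x_3x_4, x_3x_4x_5). Then depth_S I/J = 3. -/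
open MvPolynomial

namespace RelativeDepth

open RingTheory.Sequence

variable (K : Type*) [Field K]

/-- The ideal `(x₁x₂, x₁x₃, x₂x₃, x₁x₄, x₃x₅)`. -/
noncomputable def idealI : Ideal (MvPolynomial (Fin 5) K) :=
  Ideal.span {X 0 * X 1, X 0 * X 2, X 1 * X 2, X 0 * X 3, X 2 * X 4}

/-- The ideal `(x₁x₂x₅, x₁x₄x₅, x₂x₃x₄, x₃x₄x₅)`. -/
noncomputable def idealJ : Ideal (MvPolynomial (Fin 5) K) :=
  Ideal.span {X 0 * X 1 * X 4, X 0 * X 3 * X 4, X 1 * X 2 * X 3, X 2 * X 3 * X 4}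

/-- The inclusion of the parameter ring `K[x₁ + x₅, x₂ + x₄ + x₅, x₃ + x₄]`. -/
noncomputable def paramHom : MvPolynomial (Fin 3) K →ₐ[K] MvPolynomial (Fin 5) K :=
  aeval ![X 0 + X 4, X 1 + X 3 + X 4, X 2 + X 3]

/-- The combination of the generators of `idealI` with given coefficients from the
parameter ring. -/
noncomputable def comb : (Fin 5 → MvPolynomial (Fin 3) K) →+ MvPolynomial (Fin 5) K where
  toFun v := paramHom K (v 0) * (X 0 * X 1) + paramHom K (v 1) * (X 0 * X 2) +
    paramHom K (v 2) * (X 1 * X 2) + paramHom K (v 3) * (X 0 * X 3) + paramHom K (v 4) * (X 2 * X 4)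
  map_zero' := by simp
  map_add' v w := by simp only [Pi.add_apply, map_add]; ring

variable {K}

lemma comb_apply (v : Fin 5 → MvPolynomial (Fin 3) K) :
    comb K v = paramHom K (v 0) * (X 0 * X 1) + paramHom K (v 1) * (X 0 * X 2) +
    paramHom K (v 2) * (X 1 * X 2) + paramHom K (v 3) * (X 0 * X 3) +
    paramHom K (v 4) * (X 2 * X 4) := rfl

lemma comb_smul (p : MvPolynomial (Fin 3) K) (v : Fin 5 → MvPolynomial (Fin 3) K) :
    comb K (p • v) = paramHom K p * comb K v := by
  simp only [comb_apply, Pi.smul_apply, smul_eq_mul, map_mul]; ring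

@[simp] lemma paramHom_X_zero : paramHom K (X 0) = X 0 + X 4 := by simp [paramHom]

@[simp] lemma paramHom_X_one : paramHom K (X 1) = X 1 + X 3 + X 4 := by simp [paramHom]

@[simp] lemma paramHom_X_two : paramHom K (X 2) = X 2 + X 3 := by simp [paramHom]

lemma comb_mem_idealI (v : Fin 5 → MvPolynomial (Fin 3) K) : comb K v ∈ idealI K := by
  have h : ∀ g ∈ ({X 0 * X 1, X 0 * X 2, X 1 * X 2, X 0 * X 3, X 2 * X 4} :
      Set (MvPolynomial (Fin 5) K)), g ∈ idealI K := fun g hg ↦ Ideal.subset_span hg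
  rw [comb_apply]
  refine add_mem (add_mem (add_mem (add_mem ?_ ?_) ?_) ?_) ?_ <;>
    exact Ideal.mul_mem_left _ _ (h _ (by simp))

lemma combination_mem_idealJ (a b c d : MvPolynomial (Fin 5) K) :
    a * (X 0 * X 1 * X 4) + b * (X 0 * X 3 * X 4) + c * (X 1 * X 2 * X 3) +
      d * (X 2 * X 3 * X 4) ∈ idealJ K := by
  have h : ∀ g ∈ ({X 0 * X 1 * X 4, X 0 * X 3 * X 4, X 1 * X 2 * X 3, X 2 * X 3 * X 4} :
      Set (MvPolynomial (Fin 5) K)), g ∈ idealJ K := fun g hg ↦ Ideal.subset_span hg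
  refine add_mem (add_mem (add_mem ?_ ?_) ?_) ?_ <;>
    exact Ideal.mul_mem_left _ _ (h _ (by simp))

lemma exists_comb_X_three_mul (v : Fin 5 → MvPolynomial (Fin 3) K) :
    ∃ w, X 3 * comb K v - comb K w ∈ idealJ K := by
  refine ⟨![0, (v 0 + v 1 - v 3) * X 1, (v 3 - v 0 - v 1) * X 0,
    v 0 * (X 1 - X 2) + v 3 * X 2, (v 0 + v 1 - v 3) * (X 1 - X 0)], ?_⟩
  convert combination_mem_idealJ 0 (-paramHom K (v 0)) (paramHom K (v 2))
    (paramHom K (v 3) + paramHom K (v 4) - paramHom K (v 0) - paramHom K (v 1)) using 1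
  simp [comb_apply]
  ring

lemma exists_comb_X_four_mul (v : Fin 5 → MvPolynomial (Fin 3) K) :
    ∃ w, X 4 * comb K v - comb K w ∈ idealJ K := by
  refine ⟨![(v 4 - v 1 - v 2) * X 2, (v 1 + v 2 - v 4) * X 1, 0,
    (v 1 + v 2 - v 4) * (X 1 - X 2), v 2 * (X 1 - X 0) + v 4 * X 0], ?_⟩
  convert combination_mem_idealJ (paramHom K (v 0))
    (paramHom K (v 3) + paramHom K (v 4) - paramHom K (v 1) - paramHom K (v 2)) 0
    (-paramHom K (v 2)) using 1
  simp [comb_apply]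
  ring

lemma exists_comb_X_mul (i : Fin 5) (v : Fin 5 → MvPolynomial (Fin 3) K) :
    ∃ w, X i * comb K v - comb K w ∈ idealJ K := by
  obtain ⟨w, hw⟩ := exists_comb_X_three_mul v
  obtain ⟨u, hu⟩ := exists_comb_X_four_mul v
  fin_cases i
  · refine ⟨(X 0 : MvPolynomial (Fin 3) K) • v - u, ?_⟩
    convert neg_mem hu using 1
    simp only [map_sub, comb_smul, paramHom_X_zero, Fin.zero_eta]
    ring
  · refine ⟨(X 1 : MvPolynomial (Fin 3) K) • v - w - u, ?_⟩
    convert neg_mem (add_mem hw hu) using 1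
    simp only [map_sub, comb_smul, paramHom_X_one, Fin.mk_one]
    ring
  · refine ⟨(X 2 : MvPolynomial (Fin 3) K) • v - w, ?_⟩
    convert neg_mem hw using 1
    simp only [map_sub, comb_smul, paramHom_X_two, Fin.reduceFinMk]
    ring
  · exact ⟨w, hw⟩
  · exact ⟨u, hu⟩

lemma exists_comb_mul (p : MvPolynomial (Fin 5) K) (v : Fin 5 → MvPolynomial (Fin 3) K) :
    ∃ w, p * comb K v - comb K w ∈ idealJ K := by
  induction p using MvPolynomial.induction_on generalizing v with
  | C r =>
    refine ⟨(C r : MvPolynomial (Fin 3) K) • v, ?_⟩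
    have : paramHom K (C r) = C r := by simp [paramHom, algebraMap_eq]
    simp [comb_smul, this]
  | add p q hp hq =>
    obtain ⟨w, hw⟩ := hp v
    obtain ⟨u, hu⟩ := hq v
    refine ⟨w + u, ?_⟩
    convert add_mem hw hu using 1
    rw [map_add]; ring
  | mul_X p i hp =>
    obtain ⟨w, hw⟩ := exists_comb_X_mul i v
    obtain ⟨u, hu⟩ := hp w
    refine ⟨u, ?_⟩
    convert add_mem (Ideal.mul_mem_left _ p hw) hu using 1
    ring

lemma exists_comb_of_mem_idealI {x : MvPolynomial (Fin 5) K} (hx : x ∈ idealI K) :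
    ∃ v, x - comb K v ∈ idealJ K := by
  refine Submodule.span_induction ?_ ⟨0, by simp⟩ ?_ ?_ hx
  · have key : ∀ i : Fin 5, comb K (Pi.single i 1) =
        ![X 0 * X 1, X 0 * X 2, X 1 * X 2, X 0 * X 3, X 2 * X 4] i := by
      intro i
      fin_cases i <;> simp [comb_apply]
    rintro g (rfl | rfl | rfl | rfl | rfl)
    · exact ⟨Pi.single 0 1, by simp [key]⟩
    · exact ⟨Pi.single 1 1, by simp [key]⟩
    · exact ⟨Pi.single 2 1, by simp [key]⟩
    · exact ⟨Pi.single 3 1, by simp [key]⟩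
    · exact ⟨Pi.single 4 1, by simp [key]⟩
  · rintro x y - - ⟨v, hv⟩ ⟨w, hw⟩
    refine ⟨v + w, ?_⟩
    convert add_mem hv hw using 1
    rw [map_add]; ring
  · rintro p x - ⟨v, hv⟩
    obtain ⟨w, hw⟩ := exists_comb_mul p v
    refine ⟨w, ?_⟩
    convert add_mem (Ideal.mul_mem_left _ p hv) hw using 1
    rw [smul_eq_mul]; ring

/-- A retraction of `paramHom` that kills `idealJ` sends an element of `idealJ` of the form
`comb K v` to zero, which gives a linear relation between the `v i`. -/
lemma relation_of_comb_mem {v : Fin 5 → MvPolynomial (Fin 3) K} (hv : comb K v ∈ idealJ K)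
    (f : Fin 5 → MvPolynomial (Fin 3) K) (h0 : f 0 + f 4 = X 0) (h1 : f 1 + f 3 + f 4 = X 1)
    (h2 : f 2 + f 3 = X 2) (g0 : f 0 * f 1 * f 4 = 0) (g1 : f 0 * f 3 * f 4 = 0)
    (g2 : f 1 * f 2 * f 3 = 0) (g3 : f 2 * f 3 * f 4 = 0) :
    v 0 * (f 0 * f 1) + v 1 * (f 0 * f 2) + v 2 * (f 1 * f 2) + v 3 * (f 0 * f 3) +
      v 4 * (f 2 * f 4) = 0 := by
  have hJ : idealJ K ≤ RingHom.ker (aeval (R := K) f) := by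
    refine Ideal.span_le.mpr ?_
    rintro g (rfl | rfl | rfl | rfl) <;> simp [RingHom.mem_ker, g0, g1, g2, g3]
  have hretr : ∀ p, bind₁ f (paramHom K p) = p := by
    intro p
    have : (bind₁ f).comp (paramHom K) = AlgHom.id K _ := by
      ext i : 1
      fin_cases i <;> simp [h0, h1, h2]
    exact DFunLike.congr_fun this p
  simpa [RingHom.mem_ker, comb_apply, hretr] using hJ hv

lemma eq_zero_of_comb_mem {v : Fin 5 → MvPolynomial (Fin 3) K} (hv : comb K v ∈ idealJ K) :
    v = 0 := by
  have hX (i : Fin 3) : (X i : MvPolynomial (Fin 3) K) ≠ 0 := X_ne_zero i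
  have hsub {i j : Fin 3} (hij : i ≠ j) : (X i - X j : MvPolynomial (Fin 3) K) ≠ 0 :=
    sub_ne_zero.mpr fun h ↦ hij (X_injective h)
  have abc := relation_of_comb_mem hv ![X 0, X 1, X 2, 0, 0]
    (by simp) (by simp) (by simp) (by simp) (by simp) (by simp) (by simp)
  have abd := relation_of_comb_mem hv ![X 0, X 1 - X 2, 0, X 2, 0]
    (by simp) (by simp) (by simp) (by simp) (by simp) (by simp) (by simp)
  have acd := relation_of_comb_mem hv ![X 0, 0, X 2 - X 1, X 1, 0]
    (by simp) (by simp) (by simp) (by simp) (by simp) (by simp) (by simp)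
  have ace := relation_of_comb_mem hv ![X 0 - X 1, 0, X 2, 0, X 1]
    (by simp) (by simp) (by simp) (by simp) (by simp) (by simp) (by simp)
  have bce := relation_of_comb_mem hv ![0, X 1 - X 0, X 2, 0, X 0]
    (by simp) (by simp) (by simp) (by simp) (by simp) (by simp) (by simp)
  simp only [Matrix.cons_val] at abc abd acd ace bce
  have h01 : v 0 * X 1 + v 1 * X 2 = 0 := by
    refine (mul_eq_zero.mp ?_).resolve_left
      (mul_ne_zero (hX 0) (hsub (i := 1) (j := 2) (by decide)))
    linear_combination X 1 * abd - X 2 * acd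
  have h2 : v 2 = 0 := by
    refine (mul_eq_zero.mp ?_).resolve_left (mul_ne_zero (hX 1) (hX 2))
    linear_combination abc - X 0 * h01
  have h4 : v 4 = 0 := by
    refine (mul_eq_zero.mp ?_).resolve_left (mul_ne_zero (hX 2) (hX 0))
    linear_combination bce - (X 1 - X 0) * X 2 * h2
  have h1 : v 1 = 0 := by
    refine (mul_eq_zero.mp ?_).resolve_left
      (mul_ne_zero (hsub (i := 0) (j := 1) (by decide)) (hX 2))
    linear_combination ace - X 2 * X 1 * h4
  have h3 : v 3 = 0 := by
    refine (mul_eq_zero.mp ?_).resolve_left (mul_ne_zero (hX 0) (hX 1))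
    linear_combination acd - X 0 * (X 2 - X 1) * h1
  have h0 : v 0 = 0 := by
    refine (mul_eq_zero.mp ?_).resolve_left (hX 1)
    linear_combination h01 - X 2 * h1
  ext1 i
  fin_cases i <;> assumption

variable (K) in
/-- The quotient `I / J` is free of rank `5` over the parameter ring. -/
noncomputable def combEquiv :
    (Fin 5 → MvPolynomial (Fin 3) K) ≃+ quotMod (idealI K) (idealJ K) :=
  AddEquiv.ofBijective
    ((Submodule.mkQ (Submodule.comap (idealI K).subtype (idealJ K))).toAddMonoidHom.comp
      ((comb K).codRestrict (idealI K) comb_mem_idealI)) <| by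
    constructor
    · refine (injective_iff_map_eq_zero _).mpr fun v hv ↦ eq_zero_of_comb_mem ?_
      simpa using hv
    · intro y
      obtain ⟨⟨x, hx⟩, rfl⟩ := Submodule.Quotient.mk_surjective _ y
      obtain ⟨v, hv⟩ := exists_comb_of_mem_idealI hx
      refine ⟨v, Eq.symm ?_⟩
      exact (Submodule.Quotient.eq _).mpr hv

lemma combEquiv_smul (p : MvPolynomial (Fin 3) K) (v : Fin 5 → MvPolynomial (Fin 3) K) :
    combEquiv K (p • v) = paramHom K p • combEquiv K v :=
  congrArg (Submodule.Quotient.mk (p := Submodule.comap (idealI K).subtype (idealJ K)))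
    (Subtype.ext (comb_smul p v))

lemma isWeaklyRegular_X {R : Type*} [CommRing R] [IsDomain R] {n : ℕ} :
    IsWeaklyRegular (MvPolynomial (Fin n) R) (List.ofFn (X : Fin n → MvPolynomial (Fin n) R)) := by
  refine ⟨fun i hi ↦ ?_⟩
  have hin : i < n := by simpa using hi
  have hspan : Ideal.ofList ((List.ofFn (X : Fin n → MvPolynomial (Fin n) R)).take i) =
      Ideal.span (X '' {j : Fin n | (j : ℕ) < i}) := by
    refine congrArg Ideal.span (Set.ext fun p ↦ ?_)
    simp only [Set.mem_ofPred_eq, List.mem_take_iff_getElem, List.getElem_ofFn, Set.mem_image]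
    constructor
    · rintro ⟨j, hj, rfl⟩
      exact ⟨⟨j, by simp at hj; lia⟩, by simp at hj ⊢; lia, rfl⟩
    · rintro ⟨j, hj, rfl⟩
      exact ⟨j, by simp; lia, rfl⟩
  rw [isSMulRegular_on_quot_iff_lsmul_comap_le]
  intro p hp
  simp only [Submodule.mem_comap, LinearMap.lsmul_apply, smul_eq_mul, Ideal.mul_top, hspan,
    List.getElem_ofFn, mem_ideal_span_X_image, Set.mem_ofPred_eq] at hp ⊢
  intro m hm
  obtain ⟨j, hj, hmj⟩ := hp (Finsupp.single ⟨i, hin⟩ 1 + m) (by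
    rw [mem_support_iff, add_comm, mul_comm, coeff_mul_X]
    exact mem_support_iff.mp hm)
  refine ⟨j, hj, ?_⟩
  have : (⟨i, hin⟩ : Fin n) ≠ j := by rintro rfl; simp at hj
  simpa [Finsupp.single_apply, this] using hmj

lemma isRegular_pi_X :
    IsRegular (Fin 5 → MvPolynomial (Fin 3) K) [X 0, X 1, (X 2 : MvPolynomial (Fin 3) K)] := by
  refine ⟨?_, fun h ↦ ?_⟩
  · have := (isWeaklyRegular_X (R := K) (n := 3)).isWeaklyRegular_lTensor
      (M₂ := Fin 5 → MvPolynomial (Fin 3) K)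
    rw [(TensorProduct.rid _ _).isWeaklyRegular_congr] at this
    simpa [List.ofFn_succ] using this
  · have h' := congrArg (Submodule.map (LinearMap.proj (0 : Fin 5))) h
    rw [Submodule.map_smul'', Submodule.map_top, LinearMap.range_eq_top.mpr
      (LinearMap.proj_surjective 0), smul_eq_mul, Ideal.mul_top] at h'
    have hle : Ideal.ofList [X 0, X 1, (X 2 : MvPolynomial (Fin 3) K)] ≤
        RingHom.ker (constantCoeff (R := K) (σ := Fin 3)) := by
      refine Ideal.span_le.mpr fun p hp ↦ ?_
      simp only [List.mem_cons, List.not_mem_nil, or_false, Set.mem_ofPred_eq] at hp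
      rcases hp with rfl | rfl | rfl <;> simp [RingHom.mem_ker]
    have := hle (h' ▸ Submodule.mem_top : (1 : MvPolynomial (Fin 3) K) ∈ _)
    simp [RingHom.mem_ker] at this

lemma isRegular_params : IsRegular (quotMod (idealI K) (idealJ K))
    [X 0 + X 4, X 1 + X 3 + X 4, (X 2 + X 3 : MvPolynomial (Fin 5) K)] := by
  refine (AddEquiv.isRegular_congr (e := combEquiv K) ?_).mp isRegular_pi_X
  refine .cons (fun v ↦ ?_) (.cons (fun v ↦ ?_) (.cons (fun v ↦ ?_) .nil))
  · rw [combEquiv_smul, paramHom_X_zero]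
  · rw [combEquiv_smul, paramHom_X_one]
  · rw [combEquiv_smul, paramHom_X_two]

lemma supportDim_add_length_le {R M : Type*} [CommRing R] [IsNoetherianRing R] [AddCommGroup M]
    [Module R M] [Module.Finite R M] {rs : List R} (h : IsWeaklyRegular M rs) :
    Module.supportDim R (M ⧸ Ideal.ofList rs • (⊤ : Submodule R M)) + rs.length ≤
      Module.supportDim R M := by
  induction rs generalizing M with
  | nil =>
    rw [Ideal.ofList_nil, Submodule.bot_smul]
    simpa using (Module.supportDim_eq_of_equiv
      (Submodule.quotEquivOfEqBot (⊥ : Submodule R M) rfl)).le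
  | cons x rs ih =>
    rw [isWeaklyRegular_cons_iff] at h
    have h1 := ih h.2
    have h2 := Module.supportDim_quotSMulTop_succ_le_of_notMem_minimalPrimes (R := R) (M := M)
      (x := x) fun _ ↦ h.1.notMem_of_mem_minimalPrimes
    rw [Module.supportDim_eq_of_equiv (Submodule.quotOfListConsSMulTopEquivQuotSMulTopInner M x rs)]
    push_cast [List.length_cons]
    rw [← add_assoc]
    exact (add_le_add_left h1 1).trans h2

lemma exists_X_mem_of_idealJ_le {P : Ideal (MvPolynomial (Fin 5) K)} (hP : P.IsPrime)
    (h : idealJ K ≤ P) : ∃ i j, i ≠ j ∧ X i ∈ P ∧ X j ∈ P := by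
  have hg : ∀ g ∈ ({X 0 * X 1 * X 4, X 0 * X 3 * X 4, X 1 * X 2 * X 3, X 2 * X 3 * X 4} :
      Set (MvPolynomial (Fin 5) K)), g ∈ P := fun g hg ↦ h (Ideal.subset_span hg)
  simp only [Set.mem_insert_iff, Set.mem_singleton_iff, forall_eq_or_imp, forall_eq,
    hP.mul_mem_iff_mem_or_mem] at hg
  by_contra! hcon
  have h01 := hcon 0 1 (by decide)
  have h02 := hcon 0 2 (by decide)
  have h03 := hcon 0 3 (by decide)
  have h04 := hcon 0 4 (by decide)
  have h12 := hcon 1 2 (by decide)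
  have h13 := hcon 1 3 (by decide)
  have h14 := hcon 1 4 (by decide)
  have h23 := hcon 2 3 (by decide)
  have h24 := hcon 2 4 (by decide)
  have h34 := hcon 3 4 (by decide)
  clear hcon
  generalize (X 0 ∈ P) = p0, (X 1 ∈ P) = p1, (X 2 ∈ P) = p2, (X 3 ∈ P) = p3,
    (X 4 ∈ P) = p4 at *
  grind

lemma ringKrullDim_quotient_idealJ_le : ringKrullDim (MvPolynomial (Fin 5) K ⧸ idealJ K) ≤ 3 := by
  rw [ringKrullDim_quotient]
  refine iSup_le fun s ↦ ?_
  obtain ⟨i, j, hij, hi, hj⟩ := exists_X_mem_of_idealJ_le s.head.1.2 s.head.2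
  let t : LTSeries (PrimeSpectrum (MvPolynomial (Fin 5) K)) :=
    s.map Subtype.val fun _ _ h ↦ h
  have hprime : (Ideal.span {(X i : MvPolynomial (Fin 5) K)}).IsPrime :=
    (Ideal.span_singleton_prime (X_ne_zero i)).mpr (X_prime)
  have h1 : (⟨_, hprime⟩ : PrimeSpectrum (MvPolynomial (Fin 5) K)) < t.head := by
    refine lt_of_le_of_ne ((Ideal.span_singleton_le_iff_mem _).mpr hi) fun h ↦ ?_
    have hj' : X j ∈ Ideal.span {(X i : MvPolynomial (Fin 5) K)} := by
      rw [PrimeSpectrum.ext_iff] at h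
      exact h.ge hj
    rw [Ideal.mem_span_singleton] at hj'
    exact hij (X_dvd_X.mp hj')
  have h0 : (⊥ : PrimeSpectrum (MvPolynomial (Fin 5) K)) < ⟨_, hprime⟩ := by
    refine bot_lt_iff_ne_bot.mpr fun h ↦ X_ne_zero (R := K) i ?_
    rw [PrimeSpectrum.ext_iff] at h
    exact Ideal.span_singleton_eq_bot.mp h
  have hlen := Order.LTSeries.length_le_krullDim ((t.cons _ h1).cons ⊥ h0)
  have hdim : Order.krullDim (PrimeSpectrum (MvPolynomial (Fin 5) K)) = 5 := by
    change ringKrullDim _ = 5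
    simp [MvPolynomial.ringKrullDim_of_isNoetherianRing]
  have hcard : ((t.cons _ h1).cons ⊥ h0).length = s.length + 2 := by
    simp only [RelSeries.cons, RelSeries.append_length, RelSeries.singleton_length]
    change 0 + (0 + s.length + 1) + 1 = _
    lia
  rw [hdim, hcard] at hlen
  norm_cast at hlen ⊢
  lia

lemma length_le_of_isRegular {rs : List (MvPolynomial (Fin 5) K)}
    (h : IsRegular (quotMod (idealI K) (idealJ K)) rs) : rs.length ≤ 3 := by
  have hle : Module.supportDim (MvPolynomial (Fin 5) K) (quotMod (idealI K) (idealJ K)) ≤ 3 := by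
    refine le_trans ?_ (ringKrullDim_quotient_idealJ_le (K := K))
    rw [← Module.supportDim_quotient_eq_ringKrullDim]
    refine Module.supportDim_le_of_injective
      (Submodule.mapQ _ (idealJ K) (idealI K).subtype le_rfl) ?_
    rw [← LinearMap.ker_eq_bot, Submodule.ker_mapQ, Submodule.mkQ_map_self]
  have hlen := (supportDim_add_length_le h.toIsWeaklyRegular).trans hle
  have := h.quot_ofList_smul_nontrivial ⊤
  have := (Module.nonempty_support_of_nontrivial (R := MvPolynomial (Fin 5) K)
    (M := quotMod (idealI K) (idealJ K) ⧸
      Ideal.ofList rs • (⊤ : Submodule (MvPolynomial (Fin 5) K)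
        (quotMod (idealI K) (idealJ K))))).to_subtype
  have := (le_add_of_nonneg_left Order.krullDim_nonneg).trans hlen
  exact_mod_cast this

end RelativeDepth

/-- for `I = (x₁x₂, x₁x₃, x₂x₃, x₁x₄, x₃x₅)` and
`J = (x₁x₂x₅, x₁x₄x₅, x₂x₃x₄, x₃x₄x₅)` in `K[x₁,…,x₅]`, `depth I/J = 3`. -/
theorem statement16 {K : Type*} [Field K]
    (I J : Ideal (MvPolynomial (Fin 5) K))
    (hI : I = Ideal.span {X 0 * X 1, X 0 * X 2, X 1 * X 2, X 0 * X 3, X 2 * X 4})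
    (hJ : J = Ideal.span
      {X 0 * X 1 * X 4, X 0 * X 3 * X 4, X 1 * X 2 * X 3, X 2 * X 3 * X 4}) :
    depthIJ I J = 3 := by
  change I = RelativeDepth.idealI K at hI
  change J = RelativeDepth.idealJ K at hJ
  subst hI hJ
  refine IsGreatest.csSup_eq ⟨⟨_, rfl, ?_, RelativeDepth.isRegular_params⟩, ?_⟩
  · have hX (i : Fin 5) : (X i : MvPolynomial (Fin 5) K) ∈ Ideal.span (Set.range X) :=
      Ideal.subset_span ⟨i, rfl⟩
    simp only [List.mem_cons, List.not_mem_nil, or_false]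
    rintro r (rfl | rfl | rfl)
    · exact add_mem (hX 0) (hX 4)
    · exact add_mem (add_mem (hX 1) (hX 3)) (hX 4)
    · exact add_mem (hX 2) (hX 3)
  · rintro k ⟨rs, rfl, -, hrs⟩
    exact RelativeDepth.length_le_of_isRegular hrs
end

section
/- Let n = 5, S = K[x_1,…,x_5], f_1 = x_2x_3, f_2 = x_1x_2, f_3 = x_3x_4, f_4 = x_3x_5, I = (f_1, f_2, f_3, f_4) and J = (x_1x_2x_4x_5). Then depth_S I/J ≤ 3. -/
open MvPolynomial

section KoszulCochain

variable {ι R M N : Type*} [CommRing R] [AddCommGroup M] [Module R M] [AddCommGroup N]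
  [Module R N]

/-- The Koszul differential of the family `x` on cochains given by arbitrary (not necessarily
alternating) functions on tuples of indices. -/
def koszulDiff (x : ι → R) {k : ℕ} (z : (Fin k → ι) → M) : (Fin (k + 1) → ι) → M :=
  fun s => ∑ j : Fin (k + 1), ((-1) ^ (j : ℕ) * x (s j)) • z (s ∘ j.succAbove)

/-- Contraction of a cochain against a finite family of coefficients. -/
def koszulContract [Fintype ι] (g : ι → R) {k : ℕ} (z : (Fin (k + 1) → ι) → M) :
    (Fin k → ι) → M :=
  fun s => ∑ j, g j • z (Fin.cons j s)

theorem koszulDiff_map (x : ι → R) {k : ℕ} (f : M →ₗ[R] N) (z : (Fin k → ι) → M)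
    (s : Fin (k + 1) → ι) :
    koszulDiff x (fun t => f (z t)) s = f (koszulDiff x z s) := by
  simp [koszulDiff]

theorem koszulDiff_two (x : ι → R) (z : (Fin 2 → ι) → M) (s : Fin 3 → ι) :
    koszulDiff x z s =
      x (s 0) • z ![s 1, s 2] - x (s 1) • z ![s 0, s 2] + x (s 2) • z ![s 0, s 1] := by
  have h0 : s ∘ Fin.succAbove 0 = ![s 1, s 2] := by funext i; fin_cases i <;> rfl
  have h1 : s ∘ Fin.succAbove 1 = ![s 0, s 2] := by funext i; fin_cases i <;> rfl
  have h2 : s ∘ Fin.succAbove 2 = ![s 0, s 1] := by funext i; fin_cases i <;> rfl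
  refine (Fin.sum_univ_three _).trans ?_
  rw [h0, h1, h2]
  simp [sub_eq_add_neg]

theorem koszulDiff_cons (x : ι → R) {k : ℕ} (z : (Fin (k + 1) → ι) → M) (i : ι)
    (s : Fin (k + 1) → ι) :
    koszulDiff x z (Fin.cons i s) = x i • z s - koszulDiff x (fun t => z (Fin.cons i t)) s := by
  have h (l : Fin (k + 1)) : (Fin.cons i s : Fin (k + 2) → ι) ∘ l.succ.succAbove =
      Fin.cons i (s ∘ l.succAbove) := by
    funext m
    refine Fin.cases ?_ (fun m => ?_) m <;> simp
  have h0 : (Fin.cons i s : Fin (k + 2) → ι) ∘ Fin.succ = s := by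
    funext m; simp
  simp only [koszulDiff]
  rw [Fin.sum_univ_succ]
  simp [h, h0, pow_succ, sub_eq_add_neg]

theorem koszulDiff_sub (x : ι → R) {k : ℕ} (z w : (Fin k → ι) → M) (s : Fin (k + 1) → ι) :
    koszulDiff x (fun t => z t - w t) s = koszulDiff x z s - koszulDiff x w s := by
  simp [koszulDiff, smul_sub]

theorem koszulDiff_smul (x : ι → R) {k : ℕ} (r : R) (z : (Fin k → ι) → M)
    (s : Fin (k + 1) → ι) :
    koszulDiff x (fun t => r • z t) s = r • koszulDiff x z s :=
  koszulDiff_map x (LinearMap.lsmul R M r) z s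

theorem koszulDiff_koszulDiff (x : ι → R) {k : ℕ} (z : (Fin k → ι) → M) :
    koszulDiff x (koszulDiff x z) = 0 := by
  induction k with
  | zero =>
    funext s
    have h (a b : Fin 0 → ι) : z a = z b := by rw [Subsingleton.elim a b]
    have hz : z = fun _ => z Fin.elim0 := funext fun a => h a _
    rw [hz]
    simp only [koszulDiff, ← Finset.sum_smul, smul_smul]
    simp [Fin.sum_univ_succ, Fin.succAbove, mul_comm]
  | succ k ih =>
    funext s
    rw [← Fin.cons_self_tail s, koszulDiff_cons]
    simp only [koszulDiff_cons, koszulDiff_sub, koszulDiff_smul]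
    rw [ih]
    simp

theorem koszulDiff_contract [Fintype ι] (x g : ι → R) {k : ℕ} (z : (Fin (k + 1) → ι) → M)
    (hz : koszulDiff x z = 0) (s : Fin (k + 1) → ι) :
    koszulDiff x (koszulContract g z) s = (∑ i, g i * x i) • z s := by
  have h (i : ι) : koszulDiff x (fun t => z (Fin.cons i t)) s = x i • z s := by
    have := koszulDiff_cons x z i s
    rw [hz] at this
    exact (sub_eq_zero.mp this.symm).symm
  calc koszulDiff x (koszulContract g z) s
      = ∑ i, g i • koszulDiff x (fun t => z (Fin.cons i t)) s := by
        simp only [koszulDiff, koszulContract, Finset.smul_sum]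
        rw [Finset.sum_comm]
        simp only [smul_smul, mul_comm]
    _ = _ := by simp only [h, smul_smul, Finset.sum_smul]

theorem eq_zero_of_koszulDiff_eq_zero [Fintype ι] (x : ι → R) {r : R}
    (hr : r ∈ Ideal.span (Set.range x)) (hreg : IsSMulRegular M r) (z : (Fin 0 → ι) → M)
    (hz : koszulDiff x z = 0) : z = 0 := by
  obtain ⟨g, rfl⟩ := Ideal.mem_span_range_iff_exists_fun.mp hr
  funext s
  refine hreg ?_
  have h (i : ι) : x i • z s = 0 := by
    have := congrFun hz (fun _ => i)
    simpa [koszulDiff, Subsingleton.elim _ s] using this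
  simp [Finset.sum_smul, mul_smul, h]

/-- Koszul cohomology vanishes in positive degrees below the length of a weakly regular sequence
contained in the ideal generated by the family. -/
theorem exists_koszulDiff_eq [Fintype ι] (x : ι → R) (rs : List R)
    (hrs : ∀ r ∈ rs, r ∈ Ideal.span (Set.range x))
    (hreg : RingTheory.Sequence.IsWeaklyRegular M rs) {k : ℕ} (hk : k + 1 < rs.length)
    (z : (Fin (k + 1) → ι) → M) (hz : koszulDiff x z = 0) :
    ∃ w : (Fin k → ι) → M, koszulDiff x w = z := by
  induction rs generalizing M k with
  | nil => simp at hk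
  | cons r rs ih =>
    rw [RingTheory.Sequence.isWeaklyRegular_cons_iff] at hreg
    obtain ⟨hr, hreg⟩ := hreg
    obtain ⟨g, hg⟩ := Ideal.mem_span_range_iff_exists_fun.mp (hrs r (by simp))
    have hrs' : ∀ r ∈ rs, r ∈ Ideal.span (Set.range x) := fun a ha => hrs a (by simp [ha])
    have hd := koszulDiff_contract x g z hz
    rw [hg] at hd
    let π : M →ₗ[R] QuotSMulTop r M := Submodule.mkQ _
    have hπ : Function.Surjective π := Submodule.mkQ_surjective _
    have hmem (m : M) (hm : π m = 0) : ∃ y, r • y = m := by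
      have := (Submodule.Quotient.mk_eq_zero _).mp hm
      simpa [Submodule.mem_smul_pointwise_iff_exists] using this
    have hcyc : koszulDiff x (fun t => π (koszulContract g z t)) = 0 := by
      funext s
      rw [koszulDiff_map, hd]
      exact (Submodule.Quotient.mk_eq_zero _).mpr
        (Submodule.smul_mem_pointwise_smul _ _ _ trivial)
    have hfin (y : (Fin k → ι) → M)
        (hy : koszulDiff x (fun t => r • y t) = koszulDiff x (koszulContract g z)) :
        ∃ w : (Fin k → ι) → M, koszulDiff x w = z := by
      refine ⟨y, funext fun s => hr ?_⟩
      have := congrFun hy s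
      rw [hd, koszulDiff_smul] at this
      exact this
    cases k with
    | zero =>
      obtain _ | ⟨r', rs⟩ := rs
      · simp at hk
      have h0 := eq_zero_of_koszulDiff_eq_zero x (hrs' r' (by simp))
        ((RingTheory.Sequence.isWeaklyRegular_cons_iff _ _ _).mp hreg).1 _ hcyc
      choose y hy using fun t => hmem _ (congrFun h0 t)
      exact hfin y (by simp only [hy])
    | succ k =>
      obtain ⟨w, hw⟩ := ih hrs' hreg (by simpa using hk) _ hcyc
      choose w' hw' using fun t => hπ (w t)
      have hdiff (t : Fin (k + 1) → ι) :
          π (koszulContract g z t - koszulDiff x w' t) = 0 := by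
        rw [map_sub, ← koszulDiff_map, sub_eq_zero, ← congrFun hw t]
        simp only [hw']
      choose y hy using fun t => hmem _ (hdiff t)
      refine hfin y (funext fun s => ?_)
      simp only [hy]
      rw [koszulDiff_sub, koszulDiff_koszulDiff]
      simp

end KoszulCochain

/-- For `I` and `J` as in `statement17`, the third Koszul cohomology of `I/J` has a nonzero class:
the image under the connecting map of the class of `x₃ e₁ ∧ e₃` on `S/I`. -/
theorem exists_koszulDiff_eq_zero_and_ne {K : Type*} [Field K]
    (I J : Ideal (MvPolynomial (Fin 5) K))
    (hI : I = Ideal.span {X 1 * X 2, X 0 * X 1, X 2 * X 3, X 2 * X 4})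
    (hJ : J = Ideal.span {X 0 * X 1 * X 3 * X 4}) :
    ∃ z : (Fin 3 → Fin 5) → quotMod I J, koszulDiff (X (R := K)) z = 0 ∧
      ∀ w : (Fin 2 → Fin 5) → quotMod I J, koszulDiff (X (R := K)) w ≠ z := by
  let δ : Fin 5 → Fin 5 → MvPolynomial (Fin 5) K := fun i j => if i = j then 1 else 0
  let c : (Fin 2 → Fin 5) → MvPolynomial (Fin 5) K := fun s =>
    X 2 * (δ (s 0) 0 * δ (s 1) 2 - δ (s 0) 2 * δ (s 1) 0)
  have hgen (i : Fin 5) : X 2 * X i - X 0 * X 2 * δ i 0 - X 2 * X 2 * δ i 2 ∈ I := by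
    have h1 : X 2 * X 1 ∈ I := by rw [hI, mul_comm]; exact Ideal.subset_span (by simp)
    have h3 : X 2 * X 3 ∈ I := by rw [hI]; exact Ideal.subset_span (by simp)
    have h4 : X 2 * X 4 ∈ I := by rw [hI]; exact Ideal.subset_span (by simp)
    fin_cases i <;> simp [δ, h1, h3, h4, mul_comm (X 2 : MvPolynomial (Fin 5) K) (X 0)]
  have hc (s : Fin 3 → Fin 5) : koszulDiff (X (R := K)) c s ∈ I := by
    have key := I.add_mem (I.sub_mem
      (I.mul_mem_right (δ (s 1) 0 * δ (s 2) 2 - δ (s 1) 2 * δ (s 2) 0) (hgen (s 0)))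
      (I.mul_mem_right (δ (s 0) 0 * δ (s 2) 2 - δ (s 0) 2 * δ (s 2) 0) (hgen (s 1))))
      (I.mul_mem_right (δ (s 0) 0 * δ (s 1) 2 - δ (s 0) 2 * δ (s 1) 0) (hgen (s 2)))
    convert key using 1
    rw [koszulDiff_two]
    simp only [c, smul_eq_mul, Matrix.cons_val_zero, Matrix.cons_val_one]
    ring
  let q : I →ₗ[MvPolynomial (Fin 5) K] quotMod I J := Submodule.mkQ _
  refine ⟨fun s => q ⟨koszulDiff (X (R := K)) c s, hc s⟩, ?_, fun w hw => ?_⟩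
  · funext s
    rw [koszulDiff_map]
    have : koszulDiff (X (R := K)) (fun s => (⟨koszulDiff (X (R := K)) c s, hc s⟩ : I)) s = 0 := by
      apply Subtype.ext
      rw [← Submodule.subtype_apply, ← koszulDiff_map]
      exact congrFun (koszulDiff_koszulDiff (X (R := K)) c) s
    rw [this, map_zero, Pi.zero_apply]
  · choose u hu using fun t => Submodule.mkQ_surjective _ (w t)
    obtain rfl : (fun t => q (u t)) = w := funext hu
    have hs := congrFun hw ![1, 0, 2]
    rw [koszulDiff_map, ← sub_eq_zero, ← map_sub] at hs
    replace hs : koszulDiff (X (R := K)) (fun t => (u t : MvPolynomial (Fin 5) K)) ![1, 0, 2] -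
        koszulDiff (X (R := K)) c ![1, 0, 2] ∈ J := by
      have := (Submodule.Quotient.mk_eq_zero _).mp hs
      rw [Submodule.mem_comap, Submodule.subtype_apply, Submodule.coe_sub,
        ← Submodule.subtype_apply, ← koszulDiff_map] at this
      exact this
    let ψ : MvPolynomial (Fin 5) K →ₐ[K] MvPolynomial (Fin 5) K := aeval ![0, X 1, X 2, 0, 0]
    have hψX (i : Fin 5) : ψ (X i) = ![0, X 1, X 2, 0, 0] i := aeval_X _ _
    clear_value ψ
    have hψJ {p} (hp : p ∈ J) : ψ p = 0 := by
      rw [hJ, Ideal.mem_span_singleton] at hp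
      obtain ⟨v, rfl⟩ := hp
      simp [hψX]
    have hψI {p} (hp : p ∈ I) : X 1 * X 2 ∣ ψ p := by
      suffices I ≤ (Ideal.span {X 1 * X 2}).comap ψ from Ideal.mem_span_singleton.mp (this hp)
      rw [hI, Ideal.span_le]
      rintro _ (rfl | rfl | rfl | rfl) <;> simp [hψX]
    obtain ⟨v, hv⟩ := hψI (u ![0, 2]).2
    obtain ⟨v', hv'⟩ := hψI (u ![1, 0]).2
    have h := hψJ hs
    rw [koszulDiff_two, koszulDiff_two] at h
    simp [c, δ, hψX, hv, hv'] at h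
    have hX : (X 1 * X 2 : MvPolynomial (Fin 5) K) ≠ 0 := by simp
    have h1 : X 1 * v + X 2 * v' = 1 := mul_left_cancel₀ hX (by linear_combination h)
    simpa using congrArg (eval (0 : Fin 5 → K)) h1

/-- for `I = (x₂x₃, x₁x₂, x₃x₄, x₃x₅)` and `J = (x₁x₂x₄x₅)` in
`K[x₁,…,x₅]`, `depth I/J ≤ 3`. -/
theorem statement17 {K : Type*} [Field K]
    (I J : Ideal (MvPolynomial (Fin 5) K))
    (hI : I = Ideal.span {X 1 * X 2, X 0 * X 1, X 2 * X 3, X 2 * X 4})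
    (hJ : J = Ideal.span {X 0 * X 1 * X 3 * X 4}) :
    depthIJ I J ≤ 3 := by
  obtain ⟨z, hz, hne⟩ := exists_koszulDiff_eq_zero_and_ne I J hI hJ
  refine csSup_le' ?_
  rintro k ⟨rs, rfl, hrs, hreg⟩
  by_contra! hlt
  obtain ⟨w, hw⟩ := exists_koszulDiff_eq X rs hrs hreg.toIsWeaklyRegular (k := 2) hlt z hz
  exact hne w hw
end

section
/- Let n = 6, S = K[x_1,…,x_6], I = (x_1, x_2, x_3, x_4x_5, x_5x_6) and J = (x_2x_4, x_3x_4, x_1x_2x_6, x_1x_3x_6, x_1x_4x_6, x_1x_5x_6, x_2x_3x_6, x_2x_5x_6, x_3x_5x_6). Then depth_S I/J ≤ 2. -/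
open MvPolynomial

section Koszul

variable {R M ι : Type*} [CommRing R] [AddCommGroup M] [Module R M]

/-- The alternating family supported on `{a, b}` with value `z` is a Koszul 2-cocycle if `z` is
killed by all the other elements `x i`. -/
theorem smul_ite_eq_smul_ite_sub_smul_ite [DecidableEq ι] {x : ι → R} {a b : ι} (hab : a ≠ b)
    {z : M} (hz : ∀ i, i ≠ a → i ≠ b → x i • z = 0) {m : ι → ι → M}
    (hm : ∀ i j, m i j = if i = a ∧ j = b then z else if i = b ∧ j = a then -z else 0)
    (i j k : ι) : x i • m j k = x j • m i k - x k • m i j := by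
  have hc : ∀ i, i = a ∨ i = b ∨ (i ≠ a ∧ i ≠ b) := fun i => by tauto
  simp only [hm]
  obtain rfl | rfl | ⟨hi, hi'⟩ := hc i <;> obtain rfl | rfl | ⟨hj, hj'⟩ := hc j <;>
    obtain rfl | rfl | ⟨hk, hk'⟩ := hc k <;> simp [*, hab.symm]

variable [Fintype ι]

/-- Vanishing of the zeroth Koszul cohomology in the presence of a regular element. -/
theorem eq_zero_of_isSMulRegular_of_forall_smul_eq_zero {x : ι → R} {r : R}
    (hr : r ∈ Ideal.span (Set.range x)) (hreg : IsSMulRegular M r) {h : M}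
    (hh : ∀ i, x i • h = 0) : h = 0 := by
  obtain ⟨a, rfl⟩ := Ideal.mem_span_range_iff_exists_fun.1 hr
  refine hreg ?_
  simp [Finset.sum_smul, mul_smul, hh]

theorem exists_eq_smul_of_mk_eq_zero {r : R} {m : M}
    (h : (Submodule.Quotient.mk m : QuotSMulTop r M) = 0) : ∃ g : M, m = r • g := by
  rw [Submodule.Quotient.mk_eq_zero, Submodule.mem_smul_pointwise_iff_exists] at h
  obtain ⟨g, -, hg⟩ := h
  exact ⟨g, hg.symm⟩

theorem mk_smul_eq_zero (r : R) (m : M) :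
    (Submodule.Quotient.mk (r • m) : QuotSMulTop r M) = 0 :=
  (Submodule.Quotient.mk_eq_zero _).2 (Submodule.smul_mem_pointwise_smul _ _ _ trivial)

/-- Vanishing of the first Koszul cohomology in the presence of a regular sequence of length 2. -/
theorem exists_eq_smul_of_isSMulRegular {x : ι → R} {r s : R}
    (hr : r ∈ Ideal.span (Set.range x)) (hs : s ∈ Ideal.span (Set.range x))
    (hreg : IsSMulRegular M r) (hreg' : IsSMulRegular (QuotSMulTop r M) s) {m : ι → M}
    (hm : ∀ i j, x i • m j = x j • m i) : ∃ g, ∀ j, m j = x j • g := by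
  obtain ⟨a, rfl⟩ := Ideal.mem_span_range_iff_exists_fun.1 hr
  set r := ∑ i, a i * x i with hrdef
  have key : ∀ j, r • m j = x j • ∑ i, a i • m i := fun j => by
    rw [hrdef, Finset.sum_smul, Finset.smul_sum]
    refine Finset.sum_congr rfl fun i _ => ?_
    rw [mul_smul, hm i j, smul_comm]
  have hz := eq_zero_of_isSMulRegular_of_forall_smul_eq_zero hs hreg'
    (h := Submodule.Quotient.mk (∑ i, a i • m i)) fun j => by
      rw [← Submodule.Quotient.mk_smul, ← key j, mk_smul_eq_zero]
  obtain ⟨g, hg⟩ := exists_eq_smul_of_mk_eq_zero hz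
  refine ⟨g, fun j => hreg ?_⟩
  change r • m j = r • x j • g
  rw [key j, hg, smul_comm]

/-- Vanishing of the second Koszul cohomology in the presence of a regular sequence of length 3. -/
theorem exists_eq_smul_sub_smul_of_isWeaklyRegular {x : ι → R} {r s t : R} {l : List R}
    (hr : r ∈ Ideal.span (Set.range x)) (hs : s ∈ Ideal.span (Set.range x))
    (ht : t ∈ Ideal.span (Set.range x))
    (hreg : RingTheory.Sequence.IsWeaklyRegular M (r :: s :: t :: l)) {m : ι → ι → M}
    (hm : ∀ i j k, x i • m j k = x j • m i k - x k • m i j) :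
    ∃ h : ι → M, ∀ j k, m j k = x j • h k - x k • h j := by
  simp only [RingTheory.Sequence.isWeaklyRegular_cons_iff] at hreg
  obtain ⟨hreg, hreg', hreg'', -⟩ := hreg
  obtain ⟨a, rfl⟩ := Ideal.mem_span_range_iff_exists_fun.1 hr
  set r := ∑ i, a i * x i with hrdef
  have key : ∀ j k, r • m j k = x j • (∑ i, a i • m i k) - x k • ∑ i, a i • m i j :=
    fun j k => by
      rw [hrdef, Finset.sum_smul, Finset.smul_sum, Finset.smul_sum, ← Finset.sum_sub_distrib]
      refine Finset.sum_congr rfl fun i _ => ?_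
      rw [mul_smul, hm i j k, smul_sub, smul_comm (a i), smul_comm (a i)]
  obtain ⟨g, hg⟩ := exists_eq_smul_of_isSMulRegular hs ht hreg' hreg''
    (m := fun k => Submodule.Quotient.mk (∑ i, a i • m i k)) fun j k => by
      rw [← sub_eq_zero, ← Submodule.Quotient.mk_smul, ← Submodule.Quotient.mk_smul,
        ← Submodule.Quotient.mk_sub, ← key j k, mk_smul_eq_zero]
  obtain ⟨g, rfl⟩ := Submodule.Quotient.mk_surjective _ g
  have hex : ∀ k, ∃ h : M, (∑ i, a i • m i k) - x k • g = r • h := fun k =>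
    exists_eq_smul_of_mk_eq_zero <| by
      rw [Submodule.Quotient.mk_sub, hg k, Submodule.Quotient.mk_smul, sub_self]
  choose h hh using hex
  refine ⟨h, fun j k => hreg ?_⟩
  change r • m j k = r • (x j • h k - x k • h j)
  rw [key j k, smul_sub, smul_comm r, smul_comm r, ← hh k, ← hh j, smul_sub, smul_sub,
    smul_comm (x k) (x j) g]
  abel

end Koszul

theorem coeff_eq_zero_of_mem_span {K σ : Type*} [CommSemiring K] {a : σ →₀ ℕ}
    {G : Set (MvPolynomial σ K)} (hG : ∀ g ∈ G, ∀ s ≤ a, coeff s g = 0)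
    {f : MvPolynomial σ K} (hf : f ∈ Ideal.span G) : coeff a f = 0 := by
  classical
  suffices h : ∀ s ≤ a, coeff s f = 0 from h a le_rfl
  induction hf using Submodule.span_induction with
  | mem g hg => exact hG g hg
  | zero => simp
  | add f g _ _ hf hg => intro s hs; rw [coeff_add, hf s hs, hg s hs, add_zero]
  | smul p f _ hf =>
    intro s hs
    rw [smul_eq_mul, coeff_mul]
    refine Finset.sum_eq_zero fun q hq => ?_
    rw [hf q.2 ((Finset.HasAntidiagonal.mem_antidiagonal.1 hq ▸ le_add_self).trans hs), mul_zero]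

/-- A monomial with exponent `e` has no coefficient below an exponent not dominating `e`. -/
theorem coeff_monomial_eq_zero_of_le {K σ : Type*} [CommSemiring K] {a e : σ →₀ ℕ} {c : K}
    (i : σ) (hi : a i < e i) (s : σ →₀ ℕ) (hs : s ≤ a) : coeff s (monomial e c) = 0 := by
  classical
  rw [coeff_monomial, if_neg]
  rintro rfl
  exact (hs i).not_gt hi

/-- for `I = (x₁, x₂, x₃, x₄x₅, x₅x₆)` and
`J = (x₂x₄, x₃x₄, x₁x₂x₆, x₁x₃x₆, x₁x₄x₆, x₁x₅x₆, x₂x₃x₆, x₂x₅x₆, x₃x₅x₆)` in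
`K[x₁,…,x₆]`, `depth I/J ≤ 2`. -/
theorem statement18 {K : Type*} [Field K]
    (I J : Ideal (MvPolynomial (Fin 6) K))
    (hI : I = Ideal.span {X 0, X 1, X 2, X 3 * X 4, X 4 * X 5})
    (hJ : J = Ideal.span
      {X 1 * X 3, X 2 * X 3, X 0 * X 1 * X 5, X 0 * X 2 * X 5, X 0 * X 3 * X 5,
       X 0 * X 4 * X 5, X 1 * X 2 * X 5, X 1 * X 4 * X 5, X 2 * X 4 * X 5}) :
    depthIJ I J ≤ 2 := by
  have hXI : X 0 ∈ I := hI ▸ Ideal.subset_span (by simp)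
  have hI3 : ∀ f ∈ I, coeff (Finsupp.single 3 1) f = 0 := fun f hf => by
    rw [hI] at hf
    refine coeff_eq_zero_of_mem_span ?_ hf
    simp only [X, monomial_mul, Set.forall_mem_insert, Set.mem_singleton_iff, forall_eq]
    refine ⟨?_, ?_, ?_, ?_, ?_⟩
    exacts [coeff_monomial_eq_zero_of_le 0 (by simp), coeff_monomial_eq_zero_of_le 1 (by simp),
      coeff_monomial_eq_zero_of_le 2 (by simp), coeff_monomial_eq_zero_of_le 4 (by simp),
      coeff_monomial_eq_zero_of_le 4 (by simp)]
  have hI5 : ∀ f ∈ I, coeff (Finsupp.single 5 1) f = 0 := fun f hf => by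
    rw [hI] at hf
    refine coeff_eq_zero_of_mem_span ?_ hf
    simp only [X, monomial_mul, Set.forall_mem_insert, Set.mem_singleton_iff, forall_eq]
    refine ⟨?_, ?_, ?_, ?_, ?_⟩
    exacts [coeff_monomial_eq_zero_of_le 0 (by simp), coeff_monomial_eq_zero_of_le 1 (by simp),
      coeff_monomial_eq_zero_of_le 2 (by simp), coeff_monomial_eq_zero_of_le 4 (by simp),
      coeff_monomial_eq_zero_of_le 4 (by simp)]
  have hJ03 : ∀ f ∈ J, coeff (Finsupp.single 0 1 + Finsupp.single 3 1) f = 0 := fun f hf => by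
    rw [hJ] at hf
    refine coeff_eq_zero_of_mem_span ?_ hf
    simp only [X, monomial_mul, Set.forall_mem_insert, Set.mem_singleton_iff, forall_eq]
    refine ⟨?_, ?_, ?_, ?_, ?_, ?_, ?_, ?_, ?_⟩
    exacts [coeff_monomial_eq_zero_of_le 1 (by simp), coeff_monomial_eq_zero_of_le 2 (by simp),
      coeff_monomial_eq_zero_of_le 5 (by simp), coeff_monomial_eq_zero_of_le 5 (by simp),
      coeff_monomial_eq_zero_of_le 5 (by simp), coeff_monomial_eq_zero_of_le 5 (by simp),
      coeff_monomial_eq_zero_of_le 5 (by simp), coeff_monomial_eq_zero_of_le 5 (by simp),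
      coeff_monomial_eq_zero_of_le 5 (by simp)]
  have hJ05 : ∀ f ∈ J, coeff (Finsupp.single 0 1 + Finsupp.single 5 1) f = 0 := fun f hf => by
    rw [hJ] at hf
    refine coeff_eq_zero_of_mem_span ?_ hf
    simp only [X, monomial_mul, Set.forall_mem_insert, Set.mem_singleton_iff, forall_eq]
    refine ⟨?_, ?_, ?_, ?_, ?_, ?_, ?_, ?_, ?_⟩
    exacts [coeff_monomial_eq_zero_of_le 1 (by simp), coeff_monomial_eq_zero_of_le 2 (by simp),
      coeff_monomial_eq_zero_of_le 1 (by simp), coeff_monomial_eq_zero_of_le 2 (by simp),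
      coeff_monomial_eq_zero_of_le 3 (by simp), coeff_monomial_eq_zero_of_le 4 (by simp),
      coeff_monomial_eq_zero_of_le 1 (by simp), coeff_monomial_eq_zero_of_le 1 (by simp),
      coeff_monomial_eq_zero_of_le 2 (by simp)]
  refine csSup_le' ?_
  rintro _ ⟨rs, rfl, hmem, hreg⟩
  match rs, hmem, hreg with
  | [], _, _ | [_], _, _ | [_, _], _, _ => simp
  | r :: s :: t :: l, hmem, hreg =>
  exfalso
  -- The class of `x₁x₆`, whose annihilator is `(x₂, x₃, x₄, x₅)`, gives a nonzero class in the
  -- second Koszul cohomology of `I/J`.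
  let z : quotMod I J := Submodule.Quotient.mk ((X 5 : MvPolynomial (Fin 6) K) • ⟨X 0, hXI⟩)
  have hz : ∀ i : Fin 6, i ≠ 0 → i ≠ 5 → (X i : MvPolynomial (Fin 6) K) • z = 0 := by
    intro i h0 h5
    rw [← Submodule.Quotient.mk_smul, Submodule.Quotient.mk_eq_zero, Submodule.mem_comap]
    change X i * (X 5 * X 0) ∈ J
    rw [show (X i * (X 5 * X 0) : MvPolynomial (Fin 6) K) = X 0 * X i * X 5 by ring, hJ]
    apply Ideal.subset_span
    obtain rfl | rfl | rfl | rfl : i = 1 ∨ i = 2 ∨ i = 3 ∨ i = 4 := by omega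
    all_goals simp only [Set.mem_insert_iff, true_or, or_true]
  let m : Fin 6 → Fin 6 → quotMod I J := fun i j =>
    if i = 0 ∧ j = 5 then z else if i = 5 ∧ j = 0 then -z else 0
  obtain ⟨h, hh⟩ := exists_eq_smul_sub_smul_of_isWeaklyRegular
    (x := (X : Fin 6 → MvPolynomial (Fin 6) K)) (m := m) (hmem r (by simp)) (hmem s (by simp))
    (hmem t (by simp)) hreg.toIsWeaklyRegular
    (smul_ite_eq_smul_ite_sub_smul_ite (by decide) hz fun _ _ => rfl)
  choose f hf using fun i => Submodule.Quotient.mk_surjective _ (h i)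
  have h05 : X 0 * (f 5).1 - X 5 * (f 0).1 - X 5 * X 0 ∈ J := by
    have h := hh 0 5
    rw [← hf, ← hf, show m 0 5 = z from rfl, eq_comm, ← sub_eq_zero, ← Submodule.Quotient.mk_smul,
      ← Submodule.Quotient.mk_smul, ← Submodule.Quotient.mk_sub, ← Submodule.Quotient.mk_sub,
      Submodule.Quotient.mk_eq_zero] at h
    exact h
  have h30 : X 3 * (f 0).1 - X 0 * (f 3).1 ∈ J := by
    have h := hh 3 0
    rw [← hf, ← hf, show m 3 0 = 0 from rfl, eq_comm, ← Submodule.Quotient.mk_smul,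
      ← Submodule.Quotient.mk_smul, ← Submodule.Quotient.mk_sub,
      Submodule.Quotient.mk_eq_zero] at h
    exact h
  have c05 := hJ05 _ h05
  have c30 := hJ03 _ h30
  rw [coeff_sub, coeff_X_mul, hI3 _ (f 3).2, sub_zero, add_comm, coeff_X_mul] at c30
  rw [coeff_sub, coeff_sub, coeff_X_mul, hI5 _ (f 5).2, add_comm, coeff_X_mul, c30, coeff_X_mul,
    coeff_X] at c05
  simp at c05
end
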